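/- arXiv:2512.22902 — 2 statements merged into one kernel-verified Lean document; each statement's English description precedes it below -/
import Mathlib

section
/- Let n be a positive integer that is not a perfect square and write 4n = f²·d₀ with d₀ > 0 a fundamental discriminant and f a positive integer. Then, as T → ∞, D_T^n = (12·T·R·h(d₀)/(π²·n^{1/2}))·∏_{p^e ∥ f} (σ₁(p^e) − χ_{d₀}(p)·σ₁(p^{e−1})) + o(T), where R = log ε_{d₀} is the regulator of the real quadratic field ℚ(√d₀) and the product is over primes p with p^e exactly dividing f. -/
open Filter Real Asymptotics

/-- `DTn n T` is the total number of `D(n)`-pairs `{a, c}` (written with `a > c`) with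
`a, c ∈ {-T, …, T}`: sets of two distinct nonzero integers whose product plus `n` is a
perfect square. -/
noncomputable def DTn (n : ℤ) (T : ℝ) : ℕ :=
  Set.ncard {ac : ℤ × ℤ | ac.2 < ac.1 ∧ ac.1 ≠ 0 ∧ ac.2 ≠ 0 ∧
    |(ac.1 : ℝ)| ≤ T ∧ |(ac.2 : ℝ)| ≤ T ∧ ∃ b : ℤ, b ^ 2 = ac.1 * ac.2 + n}

/-- `d` is a fundamental discriminant: the discriminant of a quadratic field, i.e. either
`d ≡ 1 (mod 4)` and squarefree, or `d = 4m` with `m ≡ 2, 3 (mod 4)` squarefree. -/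
def IsFundamentalDiscriminant (d : ℤ) : Prop :=
  (d % 4 = 1 ∧ Squarefree d) ∨
    ∃ m : ℤ, d = 4 * m ∧ (m % 4 = 2 ∨ m % 4 = 3) ∧ Squarefree m

open scoped Classical in
/-- The Kronecker symbol `χ_{d}(p) = (d / p)` attached to a fundamental discriminant `d`,
evaluated at a prime `p`. -/
noncomputable def kroneckerChi (d : ℤ) (p : ℕ) : ℤ :=
  if p = 2 then (if d % 8 = 1 then 1 else if d % 8 = 5 then -1 else 0)
  else if (p : ℤ) ∣ d then 0
  else if IsSquare ((d : ZMod p)) then 1 else -1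

/-- `σ₁(m)`: the sum of the positive divisors of `m`. -/
def sigmaOne (m : ℕ) : ℕ := ∑ d ∈ m.divisors, d

/-- `ω(d)`: the number of units, i.e. `4` if `d = -4`, `6` if `d = -3`, `2` otherwise. -/
def omegaDisc (d : ℤ) : ℕ := if d = -4 then 4 else if d = -3 then 6 else 2

/-- If the means of `a` converge to `κ` and `∑ |g m| / m` converges, then the means of the
Dirichlet convolution `g * a` converge to `(∑ g m / m) * κ`. -/
lemma tendsto_mean_dirichlet_mul (g a : ArithmeticFunction ℝ) {κ : ℝ}
    (ha : Tendsto (fun N : ℕ => (∑ m ∈ Finset.Ioc 0 N, a m) / N) atTop (nhds κ))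
    (hg : Summable fun m : ℕ => ‖g m / m‖) :
    Tendsto (fun N : ℕ => (∑ m ∈ Finset.Ioc 0 N, (g * a) m) / N) atTop
      (nhds ((∑' m : ℕ, g m / m) * κ)) := by
  set A : ℕ → ℝ := fun N => ∑ m ∈ Finset.Ioc 0 N, a m with hA
  obtain ⟨C, hC⟩ : ∃ C, ∀ N : ℕ, |A N / N| ≤ C := by
    obtain ⟨C, hC⟩ := ha.abs.bddAbove_range
    exact ⟨C, fun N => hC ⟨N, rfl⟩⟩
  have hC0 : 0 ≤ C := (abs_nonneg _).trans (hC 0)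
  have hAC : ∀ N : ℕ, |A N| ≤ C * N := by
    intro N
    rcases Nat.eq_zero_or_pos N with rfl | hN
    · simp [hA]
    · have h := hC N
      rw [abs_div, Nat.abs_cast, div_le_iff₀ (by positivity)] at h
      exact h
  have key : ∀ N : ℕ, (∑ m ∈ Finset.Ioc 0 N, (g * a) m) / N
      = ∑' d : ℕ, g d * (A (N / d) / N) := by
    intro N
    rw [ArithmeticFunction.sum_Ioc_mul_eq_sum_sum, Finset.sum_div, tsum_eq_sum (s := Finset.Ioc 0 N)]
    · exact Finset.sum_congr rfl fun d _ => by rw [mul_div_assoc]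
    · intro d hd
      rcases Nat.eq_zero_or_pos d with rfl | hd0
      · simp
      · have : N < d := by simpa [hd0] using hd
        simp [Nat.div_eq_of_lt this, hA]
  simp_rw [key]
  rw [← tsum_mul_right]
  refine tendsto_tsum_of_dominated_convergence (bound := fun d : ℕ => C * ‖g d / d‖)
    (hg.mul_left C) ?_ ?_
  · intro d
    rcases Nat.eq_zero_or_pos d with rfl | hd
    · simp
    · have h1 : Tendsto (fun N : ℕ => A (N / d) / ((N / d : ℕ) : ℝ)) atTop (nhds κ) :=
        ha.comp (Nat.tendsto_div_const_atTop hd.ne')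
      have h2 : Tendsto (fun N : ℕ => ((N / d : ℕ) : ℝ) / N) atTop (nhds (1 / d)) := by
        have h := (tendsto_nat_floor_div_atTop (R := ℝ)).comp
          ((tendsto_natCast_atTop_atTop (R := ℝ)).atTop_div_const (r := (d : ℝ)) (by positivity))
        have h3 := h.mul_const (1 / (d : ℝ))
        rw [one_mul] at h3
        refine h3.congr fun N => ?_
        simp only [Function.comp_apply]
        rw [Nat.floor_div_eq_div]
        rcases Nat.eq_zero_or_pos N with rfl | hN
        · simp
        · field_simp
      have h3 := ((h1.mul h2).const_mul (g d))
      have e : g d * (κ * (1 / (d : ℝ))) = g d / d * κ := by ring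
      rw [e] at h3
      refine h3.congr fun N => ?_
      rcases Nat.eq_zero_or_pos (N / d) with h0 | h0
      · simp [h0, hA]
      · have : ((N / d : ℕ) : ℝ) ≠ 0 := by positivity
        field_simp
  · filter_upwards [eventually_gt_atTop 0] with N hN d
    rcases Nat.eq_zero_or_pos d with rfl | hd
    · simp
    · rw [norm_mul, norm_div, Real.norm_natCast, mul_comm, norm_div, Real.norm_natCast,
        Real.norm_eq_abs (A (N / d))]
      have h1 : |A (N / d)| / N ≤ C * (d : ℝ)⁻¹ := by
        rw [div_le_iff₀ (by positivity)]
        refine (hAC _).trans ?_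
        rw [mul_assoc]
        gcongr
        rw [inv_mul_eq_div]
        exact Nat.cast_div_le
      calc |A (N / d)| / N * ‖g d‖ ≤ C * (d : ℝ)⁻¹ * ‖g d‖ := by gcongr
        _ = _ := by ring

/-- The arithmetic function with `k ^ 2 ↦ μ k` which vanishes off the squares. -/
noncomputable def squareMoebius : ArithmeticFunction ℝ where
  toFun m := if IsSquare m then (ArithmeticFunction.moebius (Nat.sqrt m) : ℝ) else 0
  map_zero' := by simp

lemma squareMoebius_sq (k : ℕ) : squareMoebius (k ^ 2) = (ArithmeticFunction.moebius k : ℝ) := by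
  rw [squareMoebius, ArithmeticFunction.coe_mk, if_pos (IsSquare.sq k), Nat.sqrt_eq']

lemma squareMoebius_of_not_isSquare {m : ℕ} (h : ¬ IsSquare m) : squareMoebius m = 0 := by
  simp [squareMoebius, h]

lemma isMultiplicative_squareMoebius : squareMoebius.IsMultiplicative := by
  refine ⟨by simpa using squareMoebius_sq 1, fun {m n} h => ?_⟩
  by_cases hmn : IsSquare (m * n)
  · obtain ⟨c, hc⟩ := hmn
    obtain ⟨a, ha⟩ := exists_associated_pow_of_mul_eq_pow
      (Nat.isUnit_iff.2 h) (hc.trans (sq c).symm)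
    obtain ⟨b, hb⟩ := exists_associated_pow_of_mul_eq_pow
      (Nat.isUnit_iff.2 h.symm)
      ((mul_comm n m).trans (hc.trans (sq c).symm))
    rw [associated_iff_eq] at ha hb
    subst ha hb
    rw [← mul_pow, squareMoebius_sq, squareMoebius_sq, squareMoebius_sq,
      ArithmeticFunction.isMultiplicative_moebius.map_mul_of_coprime
        ((Nat.coprime_pow_left_iff two_pos _ _).1 ((Nat.coprime_pow_right_iff two_pos _ _).1 h))]
    push_cast
    rfl
  · rw [squareMoebius_of_not_isSquare hmn]
    by_cases hm : IsSquare m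
    · by_cases hn : IsSquare n
      · exact absurd (hm.mul hn) hmn
      · rw [squareMoebius_of_not_isSquare hn, mul_zero]
    · rw [squareMoebius_of_not_isSquare hm, zero_mul]

lemma squareMoebius_prime_pow {p : ℕ} (hp : p.Prime) (k : ℕ) :
    squareMoebius (p ^ k) = if k = 0 then 1 else if k = 2 then -1 else 0 := by
  rcases Nat.even_or_odd' k with ⟨j, rfl | rfl⟩
  · rw [mul_comm, pow_mul, squareMoebius_sq]
    rcases j with _ | _ | j
    · simp
    · simp [ArithmeticFunction.moebius_apply_prime hp]
    · rw [ArithmeticFunction.moebius_apply_prime_pow hp (by omega)]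
      simp
  · rw [squareMoebius_of_not_isSquare, if_neg (by omega), if_neg (by omega)]
    rintro ⟨c, hc⟩
    have := congrArg (fun m => m.factorization p) hc
    have hc0 : c ≠ 0 := by
      rintro rfl
      simp [hp.ne_zero] at hc
    simp [hp.factorization, Nat.factorization_mul hc0 hc0] at this
    omega

lemma hasSum_squareMoebius_div :
    HasSum (fun m : ℕ => squareMoebius m / m) (6 / π ^ 2) := by
  have hinj : Function.Injective (fun k : ℕ => k ^ 2) := Nat.pow_left_injective two_ne_zero
  rw [← hinj.hasSum_iff]
  · have h2 : (1 : ℝ) < (2 : ℂ).re := by norm_num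
    have hs := ((ArithmeticFunction.LSeriesSummable_moebius_iff).2 h2).LSeriesHasSum
    have h := LSeries_one_mul_Lseries_moebius h2
    rw [LSeries_one_eq_riemannZeta h2, riemannZeta_two] at h
    have h' : LSeries (fun n => ((ArithmeticFunction.moebius n : ℤ) : ℂ)) 2
        = ((6 / π ^ 2 : ℝ) : ℂ) := by
      have hpi : (π : ℂ) ≠ 0 := by exact_mod_cast Real.pi_ne_zero
      push_cast
      rw [eq_div_iff (pow_ne_zero 2 hpi)]
      linear_combination 6 * h
    rw [LSeriesHasSum, h'] at hs
    rw [← Complex.hasSum_ofReal]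
    convert hs using 1
    ext k
    rcases Nat.eq_zero_or_pos k with rfl | hk
    · simp
    · simp only [Function.comp_apply, squareMoebius_sq]
      rw [LSeries.term_of_ne_zero hk.ne']
      norm_cast
  · intro m hm
    rw [squareMoebius_of_not_isSquare, zero_div]
    rintro ⟨c, rfl⟩
    exact hm ⟨c, sq c⟩

lemma summable_norm_squareMoebius_div : Summable fun m : ℕ => ‖squareMoebius m / m‖ :=
  summable_norm_iff.2 hasSum_squareMoebius_div.summable

/-- The number of square roots of `n` modulo `a`. -/
def sqrtCount (n : ℤ) (a : ℕ) : ℕ :=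
  ((Finset.range a).filter fun b : ℕ => (a : ℤ) ∣ (b : ℤ) ^ 2 - n).card

/-- The `D(n)`-pairs of positive integers with larger element in `(n, M]`. -/
def largePairs (n : ℤ) (M : ℕ) : Set (ℤ × ℤ) :=
  {ac | ac.2 < ac.1 ∧ 0 < ac.2 ∧ n < ac.1 ∧ ac.1 ≤ M ∧ ∃ b : ℤ, b ^ 2 = ac.1 * ac.2 + n}

lemma ncard_largePairs {n : ℤ} (hn : 0 < n) (hns : ¬∃ m : ℤ, n = m ^ 2) (M : ℕ) :
    (largePairs n M).ncard = ∑ a ∈ Finset.Ioc n.toNat M, sqrtCount n a := by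
  set s : Finset (Σ _ : ℕ, ℕ) := (Finset.Ioc n.toNat M).sigma fun a =>
    (Finset.range a).filter fun b : ℕ => (a : ℤ) ∣ (b : ℤ) ^ 2 - n with hs
  have hcard : s.card = ∑ a ∈ Finset.Ioc n.toNat M, sqrtCount n a := by
    rw [hs, Finset.card_sigma]
    rfl
  set i : (Σ _ : ℕ, ℕ) → ℤ × ℤ := fun x => ((x.1 : ℤ), ((x.2 : ℤ) ^ 2 - n) / x.1) with hi
  have himg : largePairs n M = i '' (s : Set (Σ _ : ℕ, ℕ)) := by
    ext ⟨a, c⟩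
    simp only [largePairs, Set.mem_ofPred_eq, Set.mem_image, hs, Finset.mem_coe, Finset.mem_sigma,
      Finset.mem_Ioc, Finset.mem_filter, Finset.mem_range, hi, Prod.mk.injEq, Sigma.exists]
    constructor
    · rintro ⟨hca, hc, hna, haM, b, hb⟩
      have ha : 0 < a := by omega
      refine ⟨a.toNat, b.natAbs, ⟨⟨by omega, by omega⟩, ?_, ?_⟩, by omega, ?_⟩
      · have h1 : b ^ 2 < a ^ 2 := by nlinarith
        have h2 := sq_lt_sq.1 h1
        rw [abs_of_pos ha, Int.abs_eq_natAbs] at h2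
        omega
      · rw [Int.natCast_natAbs, sq_abs, Int.toNat_of_nonneg ha.le, hb]
        exact ⟨c, by ring⟩
      · rw [Int.natCast_natAbs, sq_abs, Int.toNat_of_nonneg ha.le, hb, add_sub_cancel_right,
          Int.mul_ediv_cancel_left _ ha.ne']
    · rintro ⟨a', b, ⟨⟨h1, h2⟩, hba, k, hk⟩, rfl, rfl⟩
      have ha : (0 : ℤ) < a' := by omega
      rw [hk, Int.mul_ediv_cancel_left _ ha.ne']
      have hk0 : k ≠ 0 := by
        rintro rfl
        exact hns ⟨b, by linarith⟩
      have hba' : (b : ℤ) < a' := by exact_mod_cast hba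
      have hna : n < (a' : ℤ) := by omega
      have hkpos : 0 < k := by
        by_contra hneg
        have : k ≤ -1 := by omega
        nlinarith [sq_nonneg (b : ℤ)]
      refine ⟨?_, hkpos, hna, by exact_mod_cast h2, b, by linarith⟩
      by_contra hge
      nlinarith
  have hinj : Set.InjOn i (s : Set (Σ _ : ℕ, ℕ)) := by
    rintro ⟨a, b⟩ h ⟨a', b'⟩ h' heq
    simp only [hs, Finset.mem_coe, Finset.mem_sigma, Finset.mem_Ioc, Finset.mem_filter,
      Finset.mem_range, hi, Prod.mk.injEq] at h h' heq
    obtain ⟨h1, h2⟩ := heq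
    obtain rfl : a = a' := by exact_mod_cast h1
    obtain ⟨-, -, k, hk⟩ := h
    obtain ⟨-, -, k', hk'⟩ := h'
    have ha : (a : ℤ) ≠ 0 := by
      rintro h0
      exact hns ⟨b, by rw [h0] at hk; linarith⟩
    rw [hk, hk', Int.mul_ediv_cancel_left _ ha, Int.mul_ediv_cancel_left _ ha] at h2
    subst h2
    have : (b : ℤ) ^ 2 = (b' : ℤ) ^ 2 := by linarith
    have : b = b' := by
      have h3 : b ^ 2 = b' ^ 2 := by exact_mod_cast this
      exact Nat.pow_left_injective two_ne_zero h3
    rw [this]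
  rw [himg, hinj.ncard_image, Set.ncard_coe_finset, hcard]

lemma finite_largePairs (n : ℤ) (M : ℕ) : (largePairs n M).Finite := by
  refine ((Set.finite_Icc (0 : ℤ) M).prod (Set.finite_Icc (0 : ℤ) M)).subset ?_
  rintro ⟨a, c⟩ ⟨h1, h2, h3, h4, -⟩
  simp only [Set.mem_prod, Set.mem_Icc] at *
  omega

lemma DTn_sub_two_mul_sum_bounded {n : ℤ} (hn : 0 < n) (hns : ¬∃ m : ℤ, n = m ^ 2) :
    ∃ C : ℝ, ∀ T : ℝ, 0 ≤ T →
      |(DTn n T : ℝ) - 2 * ∑ a ∈ Finset.Ioc 0 ⌊T⌋₊, (sqrtCount n a : ℝ)| ≤ C := by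
  set B : Set (ℤ × ℤ) := Set.Icc (-n) n ×ˢ Set.Icc (-n) n with hB
  have hBfin : B.Finite := (Set.finite_Icc _ _).prod (Set.finite_Icc _ _)
  set σ : ℤ × ℤ → ℤ × ℤ := fun x => (-x.2, -x.1) with hσ
  have hσinj : Function.Injective σ := by
    rintro ⟨a, b⟩ ⟨c, d⟩ h
    simp only [hσ, Prod.mk.injEq, neg_inj] at h
    rw [h.1, h.2]
  refine ⟨B.ncard + 2 * ∑ a ∈ Finset.Ioc 0 n.toNat, (sqrtCount n a : ℝ), fun T hT => ?_⟩
  set M := ⌊T⌋₊ with hM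
  have habs : ∀ a : ℤ, |(a : ℝ)| ≤ T ↔ |a| ≤ (M : ℤ) := by
    intro a
    rw [hM, ← Int.cast_abs, Int.natCast_floor_eq_floor hT, Int.le_floor]
  set S : Set (ℤ × ℤ) := {ac : ℤ × ℤ | ac.2 < ac.1 ∧ ac.1 ≠ 0 ∧ ac.2 ≠ 0 ∧
    |(ac.1 : ℝ)| ≤ T ∧ |(ac.2 : ℝ)| ≤ T ∧ ∃ b : ℤ, b ^ 2 = ac.1 * ac.2 + n} with hS
  have hDT : DTn n T = S.ncard := rfl
  have hunion : S = (largePairs n M ∪ σ '' largePairs n M) ∪ (S ∩ B) := by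
    ext ⟨a, c⟩
    simp only [Set.mem_union, Set.mem_inter_iff]
    constructor
    · intro h
      obtain ⟨h1, h2, h3, h4, h5, b, hb⟩ := id h
      simp only [habs, abs_le] at h1 h2 h3 h4 h5 hb
      by_cases hbox : (a, c) ∈ B
      · exact Or.inr ⟨h, hbox⟩
      left
      simp only [hB, Set.mem_prod, Set.mem_Icc, not_and_or, not_le] at hbox
      have hprod : 0 < a * c := by
        by_contra hneg
        have hac : |a * c| ≤ n := by
          rw [abs_of_nonpos (by linarith)]
          nlinarith [sq_nonneg b]
        rw [abs_mul] at hac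
        have ha1 : 1 ≤ |a| := Int.one_le_abs h2
        have hc1 : 1 ≤ |c| := Int.one_le_abs h3
        have ha2 : |a| ≤ n := by nlinarith
        have hc2 : |c| ≤ n := by nlinarith
        rw [abs_le] at ha2 hc2
        omega
      rcases pos_and_pos_or_neg_and_neg_of_mul_pos hprod with ⟨ha, hc⟩ | ⟨ha, hc⟩
      · left
        exact ⟨h1, hc, by simp only; omega, h4.2, b, hb⟩
      · right
        refine ⟨(-c, -a), ⟨by simpa using h1, by simpa using ha, by simp only; omega,
          by simp only; omega, b, by rw [hb]; ring⟩, by simp [hσ]⟩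
    · rintro ((⟨h1, h2, h3, h4, b, hb⟩ | ⟨⟨a', c'⟩, ⟨h1, h2, h3, h4, b, hb⟩, heq⟩) | h)
      · simp only [hS, Set.mem_ofPred_eq, habs, abs_le] at *
        exact ⟨h1, by omega, by omega, by omega, by omega, b, hb⟩
      · simp only [hσ, Prod.mk.injEq] at heq
        obtain ⟨rfl, rfl⟩ := heq
        simp only [hS, Set.mem_ofPred_eq, habs, abs_le] at *
        exact ⟨by omega, by omega, by omega, by omega, by omega, b, by rw [hb]; ring⟩
      · exact h.1
  have hLfin := finite_largePairs n M
  have hd1 : Disjoint (largePairs n M) (σ '' largePairs n M) := by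
    rw [Set.disjoint_left]
    rintro ⟨a, c⟩ ⟨-, h2, -⟩ ⟨⟨a', c'⟩, ⟨h1', h2', -⟩, heq⟩
    simp only [hσ, Prod.mk.injEq] at *
    omega
  have hd2 : Disjoint (largePairs n M ∪ σ '' largePairs n M) (S ∩ B) := by
    rw [Set.disjoint_left]
    rintro ⟨a, c⟩ (⟨h1, h2, h3, -⟩ | ⟨⟨a', c'⟩, ⟨h1', h2', h3', -⟩, heq⟩) ⟨-, hbox⟩
    · simp only [hB, Set.mem_prod, Set.mem_Icc] at *
      omega
    · simp only [hσ, Prod.mk.injEq, hB, Set.mem_prod, Set.mem_Icc] at *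
      omega
  have hcard : S.ncard = 2 * (largePairs n M).ncard + (S ∩ B).ncard := by
    conv_lhs => rw [hunion]
    rw [Set.ncard_union_eq hd2 (hLfin.union (hLfin.image _)) (hBfin.subset Set.inter_subset_right),
      Set.ncard_union_eq hd1 hLfin (hLfin.image _), Set.ncard_image_of_injective _ hσinj]
    ring
  have hle : (S ∩ B).ncard ≤ B.ncard := Set.ncard_le_ncard Set.inter_subset_right hBfin
  have hsum : ∃ E : ℝ, 0 ≤ E ∧ E ≤ ∑ a ∈ Finset.Ioc 0 n.toNat, (sqrtCount n a : ℝ) ∧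
      ∑ a ∈ Finset.Ioc 0 M, (sqrtCount n a : ℝ) = (largePairs n M).ncard + E := by
    rw [ncard_largePairs hn hns]
    push_cast
    rcases le_total n.toNat M with h | h
    · refine ⟨_, Finset.sum_nonneg fun _ _ => Nat.cast_nonneg _, le_rfl, ?_⟩
      rw [add_comm, Finset.sum_Ioc_consecutive _ (Nat.zero_le _) h]
    · refine ⟨_, Finset.sum_nonneg fun _ _ => Nat.cast_nonneg _,
        Finset.sum_le_sum_of_subset_of_nonneg (Finset.Ioc_subset_Ioc_right h)
          fun _ _ _ => Nat.cast_nonneg _, ?_⟩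
      rw [Finset.Ioc_eq_empty_of_le h]
      simp
  obtain ⟨E, hE0, hE1, hE2⟩ := hsum
  rw [hDT, hcard, hE2]
  push_cast
  have hle' : ((S ∩ B).ncard : ℝ) ≤ B.ncard := by exact_mod_cast hle
  have h0 : (0 : ℝ) ≤ (S ∩ B).ncard := Nat.cast_nonneg _
  rw [abs_le]
  constructor <;> linarith

lemma sqrtCount_eq_card (n : ℤ) {a : ℕ} (ha : a ≠ 0) :
    sqrtCount n a = Nat.card {b : ZMod a // b ^ 2 = n} := by
  have : NeZero a := ⟨ha⟩
  rw [sqrtCount, ← Nat.card_eq_finsetCard]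
  refine Nat.card_congr
    { toFun := fun x => ⟨(x.1 : ZMod a), ?_⟩
      invFun := fun x => ⟨x.1.val, ?_⟩
      left_inv := ?_
      right_inv := ?_ }
  · have h := (Finset.mem_filter.1 x.2).2
    rw [← ZMod.intCast_zmod_eq_zero_iff_dvd] at h
    push_cast at h
    exact sub_eq_zero.1 h
  · rw [Finset.mem_filter, Finset.mem_range]
    refine ⟨x.1.val_lt, ?_⟩
    rw [← ZMod.intCast_zmod_eq_zero_iff_dvd]
    push_cast
    rw [ZMod.natCast_zmod_val, x.2, sub_self]
  · rintro ⟨b, hb⟩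
    simp only [Subtype.mk.injEq]
    exact ZMod.val_cast_of_lt (Finset.mem_range.1 (Finset.mem_filter.1 hb).1)
  · rintro ⟨b, hb⟩
    simp

lemma sqrtCount_mul_of_coprime (n : ℤ) {a b : ℕ} (h : a.Coprime b) :
    sqrtCount n (a * b) = sqrtCount n a * sqrtCount n b := by
  rcases eq_or_ne a 0 with rfl | ha
  · simp [sqrtCount]
  rcases eq_or_ne b 0 with rfl | hb
  · simp [sqrtCount]
  rw [sqrtCount_eq_card n (mul_ne_zero ha hb), sqrtCount_eq_card n ha, sqrtCount_eq_card n hb,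
    ← Nat.card_prod]
  let e := ZMod.chineseRemainder h
  refine Nat.card_congr ((e.toEquiv.subtypeEquiv
    (q := fun y : ZMod a × ZMod b => y.1 ^ 2 = (n : ZMod a) ∧ y.2 ^ 2 = (n : ZMod b)) ?_).trans
    (Equiv.subtypeProdEquivProd (p := fun y : ZMod a => y ^ 2 = (n : ZMod a))
      (q := fun y : ZMod b => y ^ 2 = (n : ZMod b))))
  intro x
  rw [← e.injective.eq_iff, map_pow, map_intCast, Prod.ext_iff]
  rfl

/-- The number of square roots of `n` modulo `a`, as an arithmetic function of `a`. -/
def sqrtCountFn (n : ℤ) : ArithmeticFunction ℝ where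
  toFun a := (sqrtCount n a : ℝ)
  map_zero' := by simp [sqrtCount]

lemma sqrtCount_one (n : ℤ) : sqrtCount n 1 = 1 := by
  simp [sqrtCount]

lemma isMultiplicative_sqrtCountFn (n : ℤ) : (sqrtCountFn n).IsMultiplicative :=
  ⟨by simp [sqrtCountFn, sqrtCount_one], fun h => by
    simp [sqrtCountFn, sqrtCount_mul_of_coprime n h]⟩

lemma sqrtCount_congr {n n' : ℤ} {a : ℕ} (h : (a : ℤ) ∣ n - n') :
    sqrtCount n a = sqrtCount n' a := by
  unfold sqrtCount
  congr 1
  refine Finset.filter_congr fun b _ => ?_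
  have e : (b : ℤ) ^ 2 - n' = (b : ℤ) ^ 2 - n + (n - n') := by ring
  rw [e, dvd_add_left h]

lemma sqrtCount_eq_zero {n : ℤ} {a : ℕ} (h : ∀ b : ℤ, ¬ (a : ℤ) ∣ b ^ 2 - n) :
    sqrtCount n a = 0 := by
  rw [sqrtCount, Finset.card_eq_zero, Finset.filter_eq_empty_iff]
  exact fun b _ => h b

lemma sqrtCount_prime_of_dvd {p : ℕ} (hp : p.Prime) {n : ℤ} (h : (p : ℤ) ∣ n) :
    sqrtCount n p = 1 := by
  rw [sqrtCount, Finset.card_eq_one]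
  refine ⟨0, ?_⟩
  ext b
  rw [Finset.mem_filter, Finset.mem_range, Finset.mem_singleton, dvd_sub_left h]
  constructor
  · rintro ⟨hb, hd⟩
    have := (Nat.prime_iff_prime_int.1 hp).dvd_of_dvd_pow hd
    exact Nat.eq_zero_of_dvd_of_lt (by exact_mod_cast this) hb
  · rintro rfl
    exact ⟨hp.pos, by simp⟩

lemma sqrtCount_prime_pow_of_not_sq_dvd {p : ℕ} (hp : p.Prime) {n : ℤ} (h : (p : ℤ) ∣ n)
    (h2 : ¬ (p : ℤ) ^ 2 ∣ n) (k : ℕ) : sqrtCount n (p ^ (k + 2)) = 0 := by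
  refine sqrtCount_eq_zero fun b hb => h2 ?_
  push_cast at hb
  have h1 : (p : ℤ) ^ 2 ∣ b ^ 2 - n := (pow_dvd_pow _ (by omega)).trans hb
  have h3 : (p : ℤ) ∣ b ^ 2 := (dvd_sub_left h).1 ((dvd_pow_self _ two_ne_zero).trans h1)
  have h4 := pow_dvd_pow_of_dvd ((Nat.prime_iff_prime_int.1 hp).dvd_of_dvd_pow h3) 2
  exact (dvd_sub_right h4).1 h1

lemma card_filter_range_mul {P : ℕ → Prop} [DecidablePred P] {q : ℕ}
    (hP : Function.Periodic P q) (m : ℕ) :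
    ((Finset.range (m * q)).filter P).card = m * ((Finset.range q).filter P).card := by
  rw [← Nat.count_eq_card_filter_range, ← Nat.count_eq_card_filter_range]
  induction m with
  | zero => simp
  | succ m ih =>
    have hper : ∀ k, P (m * q + k) = P k := by
      intro k
      rw [add_comm]
      simpa using hP.nsmul m k
    rw [add_mul, one_mul, Nat.count_add, ih]
    simp only [hper]
    ring

lemma sqrtCount_prime_sq_mul {p : ℕ} (hp : p.Prime) (n : ℤ) (k : ℕ) :
    sqrtCount (p ^ 2 * n) (p ^ (k + 2)) = p * sqrtCount n (p ^ k) := by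
  have hp0 : (p : ℤ) ^ 2 ≠ 0 := pow_ne_zero 2 (by exact_mod_cast hp.ne_zero)
  have hper : Function.Periodic (fun b : ℕ => ((p ^ k : ℕ) : ℤ) ∣ (b : ℤ) ^ 2 - n) (p ^ k) := by
    intro b
    have e : (((b + p ^ k : ℕ) : ℤ)) ^ 2 - n
        = ((b : ℤ) ^ 2 - n) + ((p ^ k : ℕ) : ℤ) * (2 * b + (p ^ k : ℕ)) := by
      push_cast
      ring
    simp only [e]
    rw [dvd_add_left (dvd_mul_right _ _)]
  rw [sqrtCount, sqrtCount, ← card_filter_range_mul hper, ← pow_succ']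
  symm
  refine Finset.card_bij (fun b _ => p * b) ?_ ?_ ?_
  · intro b hb
    rw [Finset.mem_filter, Finset.mem_range] at hb ⊢
    refine ⟨?_, ?_⟩
    · rw [show p ^ (k + 2) = p * p ^ (k + 1) by ring]
      exact Nat.mul_lt_mul_of_pos_left hb.1 hp.pos
    · have := mul_dvd_mul_left ((p : ℤ) ^ 2) hb.2
      push_cast at this ⊢
      rwa [show (p : ℤ) ^ (k + 2) = p ^ 2 * p ^ k by ring,
        show ((p : ℤ) * b) ^ 2 - p ^ 2 * n = p ^ 2 * ((b : ℤ) ^ 2 - n) by ring]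
  · intro a _ b _ h
    exact Nat.eq_of_mul_eq_mul_left hp.pos h
  · intro b hb
    rw [Finset.mem_filter, Finset.mem_range] at hb
    obtain ⟨hlt, hd⟩ := hb
    have h1 : (p : ℤ) ^ 2 ∣ (b : ℤ) ^ 2 - p ^ 2 * n := by
      refine dvd_trans ?_ hd
      push_cast
      exact pow_dvd_pow _ (by omega)
    have h2 : (p : ℤ) ^ 2 ∣ (b : ℤ) ^ 2 := (dvd_sub_left (dvd_mul_right _ _)).1 h1
    have h3 : p ∣ b := by
      have := (Int.pow_dvd_pow_iff two_ne_zero).1 h2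
      exact_mod_cast this
    obtain ⟨c, rfl⟩ := h3
    refine ⟨c, ?_, rfl⟩
    rw [Finset.mem_filter, Finset.mem_range]
    constructor
    · rw [show p ^ (k + 2) = p * p ^ (k + 1) by ring] at hlt
      exact Nat.lt_of_mul_lt_mul_left hlt
    · refine (mul_dvd_mul_iff_left hp0).1 ?_
      push_cast at hd ⊢
      rwa [show (p : ℤ) ^ (k + 2) = p ^ 2 * p ^ k by ring,
        show ((p : ℤ) * c) ^ 2 - p ^ 2 * n = p ^ 2 * ((c : ℤ) ^ 2 - n) by ring] at hd

lemma exists_sq_sub_dvd_of_isSquare {p : ℕ} (hp : p.Prime) (hp2 : p ≠ 2) {n : ℤ}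
    (hn : ¬ (p : ℤ) ∣ n) (hs : IsSquare (n : ZMod p)) (k : ℕ) :
    ∃ u : ℤ, (p : ℤ) ^ (k + 1) ∣ u ^ 2 - n := by
  induction k with
  | zero =>
    obtain ⟨r, hr⟩ := hs
    obtain ⟨u, rfl⟩ := ZMod.intCast_surjective r
    refine ⟨u, ?_⟩
    rw [zero_add, pow_one, ← ZMod.intCast_zmod_eq_zero_iff_dvd]
    push_cast
    rw [hr]
    ring
  | succ k ih =>
    obtain ⟨u, m, hm⟩ := ih
    have hpi := Nat.prime_iff_prime_int.1 hp
    have hu : ¬ (p : ℤ) ∣ 2 * u := by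
      intro hd
      rcases hpi.dvd_or_dvd hd with h | h
      · have h' : p ∣ 2 := by exact_mod_cast h
        exact hp2 ((Nat.prime_dvd_prime_iff_eq hp Nat.prime_two).1 h')
      · refine hn ((dvd_sub_right (h.trans (dvd_pow_self u two_ne_zero))).1 ?_)
        rw [hm]
        exact (dvd_pow_self _ (by omega)).mul_right _
    obtain ⟨a, b, hab⟩ := (hpi.coprime_iff_not_dvd.2 hu).symm
    refine ⟨u - m * a * p ^ (k + 1), m * b + (m * a) ^ 2 * p ^ k, ?_⟩
    have e : (u - m * a * (p : ℤ) ^ (k + 1)) ^ 2 - n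
        = (u ^ 2 - n) - p ^ (k + 1) * (m * (a * (2 * u))) + (m * a) ^ 2 * p ^ (k + 1) * p ^ (k + 1) := by
      ring
    rw [e, hm, show a * (2 * u) = 1 - b * p by linarith]
    ring

lemma sqrtCount_prime_pow_of_isSquare {p : ℕ} (hp : p.Prime) (hp2 : p ≠ 2) {n : ℤ}
    (hn : ¬ (p : ℤ) ∣ n) (hs : IsSquare (n : ZMod p)) (k : ℕ) :
    sqrtCount n (p ^ (k + 1)) = 2 := by
  have hpi := Nat.prime_iff_prime_int.1 hp
  obtain ⟨u, hu⟩ := exists_sq_sub_dvd_of_isSquare hp hp2 hn hs k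
  have h2u : ¬ (p : ℤ) ∣ 2 * u := by
    intro hd
    rcases hpi.dvd_or_dvd hd with h | h
    · have h' : p ∣ 2 := by exact_mod_cast h
      exact hp2 ((Nat.prime_dvd_prime_iff_eq hp Nat.prime_two).1 h')
    · exact hn ((dvd_sub_right (h.trans (dvd_pow_self u two_ne_zero))).1
        ((dvd_pow_self _ (by omega)).trans hu))
  rw [sqrtCount_eq_card n (pow_ne_zero _ hp.ne_zero)]
  have hset : {b : ZMod (p ^ (k + 1)) | b ^ 2 = n} =
      ({(u : ZMod (p ^ (k + 1))), -(u : ZMod (p ^ (k + 1)))} :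
      Set (ZMod (p ^ (k + 1)))) := by
    ext b
    obtain ⟨b, rfl⟩ := ZMod.intCast_surjective b
    simp only [Set.mem_ofPred_eq, Set.mem_insert_iff, Set.mem_singleton_iff]
    have e1 : ((b : ZMod (p ^ (k + 1))) ^ 2 = n) ↔ (p : ℤ) ^ (k + 1) ∣ b ^ 2 - n := by
      rw [← sub_eq_zero]
      have := ZMod.intCast_zmod_eq_zero_iff_dvd (b ^ 2 - n) (p ^ (k + 1))
      push_cast at this
      exact this
    have e2 : ((b : ZMod (p ^ (k + 1))) = u) ↔ (p : ℤ) ^ (k + 1) ∣ b - u := by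
      rw [← sub_eq_zero]
      have := ZMod.intCast_zmod_eq_zero_iff_dvd (b - u) (p ^ (k + 1))
      push_cast at this
      exact this
    have e3 : ((b : ZMod (p ^ (k + 1))) = -u) ↔ (p : ℤ) ^ (k + 1) ∣ b + u := by
      rw [eq_neg_iff_add_eq_zero]
      have := ZMod.intCast_zmod_eq_zero_iff_dvd (b + u) (p ^ (k + 1))
      push_cast at this
      exact this
    rw [e1, e2, e3]
    have e4 : b ^ 2 - n = (b - u) * (b + u) + (u ^ 2 - n) := by ring
    rw [e4, dvd_add_left hu]
    constructor
    · intro h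
      by_cases hd : (p : ℤ) ∣ b + u
      · right
        refine hpi.pow_dvd_of_dvd_mul_left _ (fun h' => h2u ?_) h
        have := dvd_sub hd h'
        rwa [show b + u - (b - u) = 2 * u by ring] at this
      · left
        exact hpi.pow_dvd_of_dvd_mul_right _ hd h
    · rintro (h | h)
      · exact h.mul_right _
      · exact h.mul_left _
  have hne : (u : ZMod (p ^ (k + 1))) ≠ -u := by
    rw [Ne, eq_neg_iff_add_eq_zero, ← two_mul]
    have := ZMod.intCast_zmod_eq_zero_iff_dvd (2 * u) (p ^ (k + 1))
    push_cast at this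
    rw [this]
    exact fun h => h2u ((dvd_pow_self _ (by omega)).trans h)
  change Set.ncard {b : ZMod (p ^ (k + 1)) | b ^ 2 = n} = 2
  rw [hset, Set.ncard_pair hne]

lemma sqrtCount_prime_pow_of_not_isSquare {p : ℕ} {n : ℤ}
    (hs : ¬ IsSquare (n : ZMod p)) (k : ℕ) : sqrtCount n (p ^ (k + 1)) = 0 := by
  refine sqrtCount_eq_zero fun b hb => hs ⟨b, ?_⟩
  have h : (p : ℤ) ∣ b ^ 2 - n := by
    refine dvd_trans ?_ hb
    push_cast
    exact dvd_pow_self _ (by omega)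
  rw [← ZMod.intCast_zmod_eq_zero_iff_dvd] at h
  push_cast at h
  rw [← sq]
  exact (sub_eq_zero.1 h).symm

lemma exists_sq_sub_two_pow_dvd {n : ℤ} (hn : n % 8 = 1) (k : ℕ) :
    ∃ u : ℤ, Odd u ∧ (2 : ℤ) ^ (k + 3) ∣ u ^ 2 - n := by
  induction k with
  | zero => exact ⟨1, odd_one, by norm_num; omega⟩
  | succ k ih =>
    obtain ⟨u, ⟨v, hv⟩, m, hm⟩ := ih
    refine ⟨u + m * 2 ^ (k + 2), ?_, m * (v + 1) + m ^ 2 * 2 ^ k, ?_⟩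
    · refine ⟨v + m * 2 ^ (k + 1), ?_⟩
      rw [hv]
      ring
    · have e : (u + m * 2 ^ (k + 2)) ^ 2 - n
          = (u ^ 2 - n) + u * m * 2 ^ (k + 3) + m ^ 2 * 2 ^ (2 * k + 4) := by ring
      rw [e, hm, hv]
      ring

lemma sqrtCount_two_pow_of_mod_eight_eq_one {n : ℤ} (hn : n % 8 = 1) (k : ℕ) :
    sqrtCount n (2 ^ (k + 3)) = 4 := by
  obtain ⟨u, ⟨v, hv⟩, hu⟩ := exists_sq_sub_two_pow_dvd hn k
  rw [sqrtCount_eq_card n (pow_ne_zero _ two_ne_zero)]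
  set h : ℤ := 2 ^ (k + 2) with hh
  have hcast : ∀ a b : ℤ, ((a : ZMod (2 ^ (k + 3))) = b) ↔ (2 : ℤ) ^ (k + 3) ∣ a - b := by
    intro a b
    rw [← sub_eq_zero]
    have := ZMod.intCast_zmod_eq_zero_iff_dvd (a - b) (2 ^ (k + 3))
    push_cast at this
    exact this
  have h2h : (2 : ℤ) ^ (k + 3) = 2 * h := by rw [hh]; ring
  have h4 : (4 : ℤ) ∣ h := ⟨2 ^ k, by rw [hh]; ring⟩
  have hpos : 0 < h := by positivity
  rw [h2h] at hu
  simp only [h2h] at hcast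
  have hset : {b : ZMod (2 ^ (k + 3)) | b ^ 2 = n}
      = (({u, u + h, -u, -u + h} : Finset ℤ).image (Int.cast : ℤ → ZMod (2 ^ (k + 3))) : Finset _) := by
    ext b
    obtain ⟨b, rfl⟩ := ZMod.intCast_surjective b
    simp only [Set.mem_ofPred_eq, Finset.coe_image, Finset.coe_insert, Finset.coe_singleton,
      Set.mem_image, Set.mem_insert_iff, Set.mem_singleton_iff, exists_eq_or_imp, exists_eq_left]
    have e1 : ((b : ZMod (2 ^ (k + 3))) ^ 2 = n) ↔ 2 * h ∣ b ^ 2 - n := by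
      rw [← hcast]
      push_cast
      rfl
    rw [e1, hcast, hcast, hcast, hcast]
    have e4 : b ^ 2 - n = (b - u) * (b + u) + (u ^ 2 - n) := by ring
    rw [e4, dvd_add_left hu]
    constructor
    · intro hd
      have hodd : Odd b := by
        rw [← Int.not_even_iff_odd]
        rintro ⟨c, hc⟩
        have h2 : (2 : ℤ) ∣ (b - u) * (b + u) := (dvd_mul_right _ _).trans hd
        have hpr := Int.prime_two.dvd_or_dvd h2
        omega
      obtain ⟨c, hc⟩ := hodd
      have key : h ∣ b - u ∨ h ∣ b + u := by
        have e5 : (b - u) * (b + u) = 4 * ((c - v) * (c + v + 1)) := by rw [hc, hv]; ring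
        have e6 : 2 * h = 4 * 2 ^ (k + 1) := by rw [hh]; ring
        rw [e5, e6, mul_dvd_mul_iff_left (by norm_num)] at hd
        have e7 : h = 2 * 2 ^ (k + 1) := by rw [hh]; ring
        rw [e7, hc, hv, show 2 * c + 1 - (2 * v + 1) = 2 * (c - v) by ring,
          show 2 * c + 1 + (2 * v + 1) = 2 * (c + v + 1) by ring,
          mul_dvd_mul_iff_left (by norm_num), mul_dvd_mul_iff_left (by norm_num)]
        by_cases h' : (2 : ℤ) ∣ c + v + 1
        · right
          exact Int.prime_two.pow_dvd_of_dvd_mul_left _ (by omega) hd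
        · left
          exact Int.prime_two.pow_dvd_of_dvd_mul_right _ h' hd
      rcases key with ⟨w, hw⟩ | ⟨w, hw⟩ <;> rcases Int.even_or_odd' w with ⟨z, rfl | rfl⟩
      · exact Or.inl ⟨-z, by linear_combination -hw⟩
      · exact Or.inr (Or.inl ⟨-z, by linear_combination -hw⟩)
      · exact Or.inr (Or.inr (Or.inl ⟨-z, by linear_combination -hw⟩))
      · exact Or.inr (Or.inr (Or.inr ⟨-z, by linear_combination -hw⟩))
    · obtain ⟨h', hh'⟩ := h4
      rintro (⟨z, hz⟩ | ⟨z, hz⟩ | ⟨z, hz⟩ | ⟨z, hz⟩)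
      · exact ⟨-z * (b + u), by linear_combination -(b + u) * hz⟩
      · obtain rfl : b = u + h - 2 * h * z := by linarith
        exact ⟨(1 - 2 * z) * (u + 2 * h' - h * z), by
          rw [hh']; ring⟩
      · exact ⟨-z * (b - u), by linear_combination -(b - u) * hz⟩
      · obtain rfl : b = -u + h - 2 * h * z := by linarith
        exact ⟨(1 - 2 * z) * (-u + 2 * h' - h * z), by
          rw [hh']; ring⟩
  have hA : ∀ z, 2 * u ≠ h * z := fun z hz => by
    have := h4.trans (Dvd.intro z hz.symm)
    omega
  have hB : ∀ z, h * (2 * z + 1) ≠ 0 := fun z => mul_ne_zero hpos.ne' (by omega)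
  have hinj : Set.InjOn (Int.cast : ℤ → ZMod (2 ^ (k + 3))) ({u, u + h, -u, -u + h} : Finset ℤ) := by
    intro x hx y hy hxy
    rw [hcast] at hxy
    obtain ⟨z, hz⟩ := hxy
    simp only [Finset.coe_insert, Finset.coe_singleton, Set.mem_insert_iff,
      Set.mem_singleton_iff] at hx hy
    rcases hx with rfl | rfl | rfl | rfl <;> rcases hy with rfl | rfl | rfl | rfl <;>
      first
      | rfl
      | exact (hB z (by linarith)).elim
      | exact (hB (-z) (by linarith)).elim
      | exact (hA (2 * z) (by linarith)).elim
      | exact (hA (-2 * z) (by linarith)).elim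
      | exact (hA (2 * z + 1) (by linarith)).elim
      | exact (hA (2 * z - 1) (by linarith)).elim
      | exact (hA (-2 * z + 1) (by linarith)).elim
      | exact (hA (-2 * z - 1) (by linarith)).elim
  rw [show Nat.card {b : ZMod (2 ^ (k + 3)) // b ^ 2 = n}
    = Set.ncard {b : ZMod (2 ^ (k + 3)) | b ^ 2 = n} from rfl, hset, Set.ncard_coe_finset,
    Finset.card_image_of_injOn hinj, Finset.card_insert_of_notMem, Finset.card_insert_of_notMem,
    Finset.card_insert_of_notMem, Finset.card_singleton]
  all_goals
    intro hx
    simp only [Finset.mem_insert, Finset.mem_singleton] at hx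
    have := hB 0
    have := hA 0
    have := hA 1
    have := hA (-1)
    omega

lemma sqrtCount_two_of_odd {n : ℤ} (hn : n % 2 = 1) : sqrtCount n 2 = 1 := by
  rw [sqrtCount_congr (n' := 1) (by push_cast; omega)]
  decide

lemma sqrtCount_four_of_mod_four_eq_one {n : ℤ} (hn : n % 4 = 1) : sqrtCount n 4 = 2 := by
  rw [sqrtCount_congr (n' := 1) (by push_cast; omega)]
  decide

lemma sqrtCount_two_pow_of_mod_four_eq_three {n : ℤ} (hn : n % 4 = 3) (k : ℕ) :
    sqrtCount n (2 ^ (k + 2)) = 0 := by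
  refine sqrtCount_eq_zero fun b hb => ?_
  have h : (4 : ℤ) ∣ b ^ 2 - n := by
    refine dvd_trans ⟨2 ^ k, ?_⟩ hb
    push_cast
    ring
  rcases Int.even_or_odd' b with ⟨c, rfl | rfl⟩
  · have : (2 * c) ^ 2 = 4 * c ^ 2 := by ring
    omega
  · have : (2 * c + 1) ^ 2 = 4 * (c ^ 2 + c) + 1 := by ring
    omega

lemma sqrtCount_two_pow_of_mod_eight_eq_five {n : ℤ} (hn : n % 8 = 5) (k : ℕ) :
    sqrtCount n (2 ^ (k + 3)) = 0 := by
  refine sqrtCount_eq_zero fun b hb => ?_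
  have h : (8 : ℤ) ∣ b ^ 2 - n := by
    refine dvd_trans ⟨2 ^ k, ?_⟩ hb
    push_cast
    ring
  rcases Int.even_or_odd b with ⟨c, rfl⟩ | hb
  · have : (c + c) ^ 2 = 4 * c ^ 2 := by ring
    omega
  · have := Int.sq_mod_four_eq_one_of_odd hb
    have h8 := Int.eight_dvd_sq_sub_one_of_odd hb
    omega

section LocalSeries
open PowerSeries

/-- The series `∑ A(p ^ k) X ^ k`. -/
noncomputable def localSeries (p : ℕ) (A : ArithmeticFunction ℝ) : PowerSeries ℝ :=
  PowerSeries.mk fun k => A (p ^ k)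

lemma localSeries_mul {p : ℕ} (hp : p.Prime) (A B : ArithmeticFunction ℝ) :
    localSeries p (A * B) = localSeries p A * localSeries p B := by
  ext k
  rw [coeff_mul, localSeries, coeff_mk, ArithmeticFunction.mul_apply,
    Nat.sum_divisorsAntidiagonal (f := fun i j => A i * B j), Nat.divisors_prime_pow hp,
    Finset.sum_map, Finset.Nat.sum_antidiagonal_eq_sum_range_succ_mk]
  refine Finset.sum_congr rfl fun i hi => ?_
  simp [localSeries, Nat.pow_div (Nat.lt_succ_iff.1 (Finset.mem_range.1 hi)) hp.pos]

lemma mk_eq_C_add_X_mul (a : ℕ → ℝ) : mk a = C (a 0) + X * PowerSeries.mk fun k => a (k + 1) := by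
  ext k
  cases k <;> simp [coeff_succ_X_mul, coeff_succ_C]

lemma mk_const_mul_one_sub_X (c : ℝ) : (PowerSeries.mk fun _ => c) * (1 - X) = C c := by
  have h : (PowerSeries.mk fun _ => c) = C c * (PowerSeries.mk 1 : PowerSeries ℝ) := by
    ext k
    simp
  rw [h, mul_assoc, mk_one_mul_one_sub_eq_one, mul_one]

lemma mk_const_zero : (PowerSeries.mk fun _ => (0 : ℝ)) = 0 := by
  ext k
  simp

/-- The local factor at a prime of norm `c` by which the generating series of square roots
changes when passing to the order of conductor exponent `e`. -/
noncomputable def conductorSeries (χ c : ℝ) : ℕ → PowerSeries ℝ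
  | 0 => 1
  | e + 1 => 1 - C χ * X + C c * X ^ 2 * conductorSeries χ c e

/-- The generating series of square roots of `n` modulo powers of `p` has conductor
exponent `e` and quadratic character value `χ`. -/
def HasConductor (p : ℕ) (χ : ℝ) (n : ℤ) (e : ℕ) : Prop :=
  localSeries p (sqrtCountFn n) * ((1 - X) * (1 - C χ * X))
    = (1 - X ^ 2) * conductorSeries χ p e

lemma localSeries_sqrtCountFn (p : ℕ) (n : ℤ) :
    localSeries p (sqrtCountFn n) = 1 + X * PowerSeries.mk fun k => (sqrtCount n (p ^ (k + 1)) : ℝ) := by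
  rw [localSeries, mk_eq_C_add_X_mul]
  simp [sqrtCountFn, sqrtCount_one]

lemma HasConductor.prime_sq_mul {p : ℕ} (hp : p.Prime) {χ : ℝ} {n : ℤ} {e : ℕ}
    (h : HasConductor p χ n e) : HasConductor p χ (p ^ 2 * n) (e + 1) := by
  have key : localSeries p (sqrtCountFn (p ^ 2 * n))
      = 1 + X + C (p : ℝ) * X ^ 2 * localSeries p (sqrtCountFn n) := by
    rw [localSeries_sqrtCountFn, mk_eq_C_add_X_mul]
    simp only [zero_add, pow_one, add_assoc, Nat.reduceAdd, sqrtCount_prime_sq_mul hp,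
      sqrtCount_prime_of_dvd hp (Dvd.intro _ (by ring : (p : ℤ) * (p * n) = p ^ 2 * n))]
    have : (PowerSeries.mk fun k => ((p * sqrtCount n (p ^ k) : ℕ) : ℝ))
        = C (p : ℝ) * localSeries p (sqrtCountFn n) := by
      ext k
      rw [coeff_C_mul]
      simp [localSeries, sqrtCountFn]
    rw [this]
    simp
    ring
  unfold HasConductor at h ⊢
  rw [key, conductorSeries]
  linear_combination C (p : ℝ) * X ^ 2 * h

lemma HasConductor.prime_pow_sq_mul {p : ℕ} (hp : p.Prime) {χ : ℝ} {n : ℤ} {e : ℕ}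
    (h : HasConductor p χ n e) (k : ℕ) : HasConductor p χ ((p ^ k) ^ 2 * n) (e + k) := by
  induction k with
  | zero => simpa using h
  | succ k ih =>
    have := ih.prime_sq_mul hp
    rwa [show (p : ℤ) ^ 2 * ((p ^ k) ^ 2 * n) = (p ^ (k + 1)) ^ 2 * n by ring] at this

lemma hasConductor_of_isSquare {p : ℕ} (hp : p.Prime) (hp2 : p ≠ 2) {n : ℤ}
    (hn : ¬ (p : ℤ) ∣ n) (hs : IsSquare (n : ZMod p)) : HasConductor p 1 n 0 := by
  unfold HasConductor
  rw [localSeries_sqrtCountFn]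
  simp only [sqrtCount_prime_pow_of_isSquare hp hp2 hn hs, conductorSeries, map_one]
  have := mk_const_mul_one_sub_X 2
  have e2 : (C 2 : PowerSeries ℝ) = 2 := map_ofNat C 2
  rw [e2] at this
  push_cast
  linear_combination X * (1 - X) * this

lemma hasConductor_of_not_isSquare {p : ℕ} {n : ℤ}
    (hs : ¬ IsSquare (n : ZMod p)) : HasConductor p (-1) n 0 := by
  unfold HasConductor
  rw [localSeries_sqrtCountFn]
  simp only [sqrtCount_prime_pow_of_not_isSquare hs, conductorSeries, map_neg, map_one,
    Nat.cast_zero, mk_const_zero]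
  ring

lemma hasConductor_of_prime_exactly_dvd {p : ℕ} (hp : p.Prime) {n : ℤ} (h : (p : ℤ) ∣ n)
    (h2 : ¬ (p : ℤ) ^ 2 ∣ n) : HasConductor p 0 n 0 := by
  unfold HasConductor
  rw [localSeries_sqrtCountFn, mk_eq_C_add_X_mul]
  simp only [zero_add, pow_one, add_assoc, Nat.reduceAdd, sqrtCount_prime_of_dvd hp h,
    sqrtCount_prime_pow_of_not_sq_dvd hp h h2, conductorSeries, map_zero,
    Nat.cast_zero, mk_const_zero, Nat.cast_one, map_one]
  ring

lemma hasConductor_two_of_mod_four_eq_three {n : ℤ} (hn : n % 4 = 3) :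
    HasConductor 2 0 n 0 := by
  unfold HasConductor
  rw [localSeries_sqrtCountFn, mk_eq_C_add_X_mul]
  simp only [zero_add, pow_one, add_assoc, Nat.reduceAdd, sqrtCount_two_of_odd (n := n) (by omega),
    sqrtCount_two_pow_of_mod_four_eq_three hn, conductorSeries, map_zero,
    Nat.cast_zero, mk_const_zero, Nat.cast_one, map_one]
  ring

lemma hasConductor_two_of_mod_eight_eq_one {n : ℤ} (hn : n % 8 = 1) :
    HasConductor 2 1 n 1 := by
  unfold HasConductor
  rw [localSeries_sqrtCountFn, mk_eq_C_add_X_mul, mk_eq_C_add_X_mul]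
  simp only [zero_add, pow_one, add_assoc, Nat.reduceAdd, sqrtCount_two_of_odd (n := n) (by omega),
    sqrtCount_two_pow_of_mod_eight_eq_one hn, conductorSeries, Nat.reducePow,
    sqrtCount_four_of_mod_four_eq_one (n := n) (by omega), Nat.cast_one, map_one]
  have := mk_const_mul_one_sub_X 4
  have e2 : (C 2 : PowerSeries ℝ) = 2 := map_ofNat C 2
  have e4 : (C 4 : PowerSeries ℝ) = 4 := map_ofNat C 4
  rw [e4] at this
  push_cast
  rw [e2]
  linear_combination X ^ 3 * (1 - X) * this

lemma hasConductor_two_of_mod_eight_eq_five {n : ℤ} (hn : n % 8 = 5) :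
    HasConductor 2 (-1) n 1 := by
  unfold HasConductor
  rw [localSeries_sqrtCountFn, mk_eq_C_add_X_mul, mk_eq_C_add_X_mul]
  simp only [zero_add, pow_one, add_assoc, Nat.reduceAdd, sqrtCount_two_of_odd (n := n) (by omega),
    sqrtCount_two_pow_of_mod_eight_eq_five hn, conductorSeries, Nat.reducePow,
    sqrtCount_four_of_mod_four_eq_one (n := n) (by omega), Nat.cast_one, map_one, map_neg,
    Nat.cast_zero, mk_const_zero]
  have e2 : (C 2 : PowerSeries ℝ) = 2 := map_ofNat C 2
  push_cast
  rw [e2]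
  ring

end LocalSeries

lemma Nat.exists_eq_pow_mul_factorization {p f : ℕ} (hp : p.Prime) (hf : f ≠ 0) :
    ∃ f', f = p ^ f.factorization p * f' ∧ ¬ p ∣ f' :=
  ⟨f / p ^ f.factorization p, (Nat.ordProj_mul_ordCompl_eq_self f p).symm,
    Nat.not_dvd_ordCompl hp hf⟩

lemma Int.isSquare_cast_iff_of_sq_mul {p : ℕ} (hp : p.Prime) (hp2 : p ≠ 2) {m d g : ℤ}
    (hg : ¬ (p : ℤ) ∣ g) (h : 4 * m = g ^ 2 * d) :
    IsSquare (m : ZMod p) ↔ IsSquare (d : ZMod p) := by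
  have : Fact p.Prime := ⟨hp⟩
  have h2 : (2 : ZMod p) ≠ 0 := by
    intro h0
    have := (ZMod.natCast_eq_zero_iff 2 p).1 (by exact_mod_cast h0)
    exact hp2 ((Nat.prime_dvd_prime_iff_eq hp Nat.prime_two).1 this)
  have hg0 : (g : ZMod p) ≠ 0 := by rwa [Ne, ZMod.intCast_zmod_eq_zero_iff_dvd]
  have h' : (2 : ZMod p) ^ 2 * m = g ^ 2 * d := by
    have := congrArg (Int.cast : ℤ → ZMod p) h
    push_cast at this
    rw [← this]
    ring
  constructor
  · rintro ⟨r, hr⟩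
    refine ⟨2 * r / g, ?_⟩
    rw [hr] at h'
    field_simp
    linear_combination -h'
  · rintro ⟨r, hr⟩
    refine ⟨g * r / 2, ?_⟩
    rw [hr] at h'
    field_simp
    linear_combination h'

lemma IsFundamentalDiscriminant.not_sq_dvd {d : ℤ} (hd : IsFundamentalDiscriminant d) {p : ℕ}
    (hp : p.Prime) (hp2 : p ≠ 2) : ¬ (p : ℤ) ^ 2 ∣ d := by
  have hpi := Nat.prime_iff_prime_int.1 hp
  have key : ∀ m : ℤ, Squarefree m → ¬ (p : ℤ) ^ 2 ∣ m := fun m hm h =>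
    hpi.not_isUnit (hm p (by rwa [← sq]))
  rcases hd with ⟨-, h⟩ | ⟨m, rfl, -, h⟩
  · exact key _ h
  · intro hdvd
    refine key _ h (IsCoprime.dvd_of_dvd_mul_left ?_ hdvd)
    have : IsCoprime ((p : ℕ) : ℤ) ((2 : ℕ) : ℤ) :=
      Nat.isCoprime_iff_coprime.2 ((Nat.coprime_primes hp Nat.prime_two).2 hp2)
    have := this.pow (m := 2) (n := 2)
    simpa using this

theorem hasConductor_factorization {n d₀ : ℤ} {f : ℕ} (hf : 0 < f)
    (hfactor : 4 * n = (f : ℤ) ^ 2 * d₀) (hfund : IsFundamentalDiscriminant d₀)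
    {p : ℕ} (hp : p.Prime) : HasConductor p (kroneckerChi d₀ p) n (f.factorization p) := by
  have hpi := Nat.prime_iff_prime_int.1 hp
  obtain ⟨g, hg, hpg⟩ := Nat.exists_eq_pow_mul_factorization hp hf.ne'
  set e := f.factorization p
  by_cases hp2 : p = 2
  · subst hp2
    have hgodd : (g : ℤ) ^ 2 % 8 = 1 := by
      have := Int.eight_dvd_sq_sub_one_of_odd (k := (g : ℤ)) (Int.odd_iff.2 (by omega))
      omega
    simp only [kroneckerChi, if_true]
    rcases hfund with ⟨hd, -⟩ | ⟨m, rfl, hm, -⟩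
    · have hmod : ((g : ℤ) ^ 2 * d₀) % 8 = d₀ % 8 := by
        rw [Int.mul_emod, hgodd]
        simp
      obtain ⟨k, hk⟩ : ∃ k, e = k + 1 := by
        rcases Nat.eq_zero_or_pos e with h0 | h0
        · exfalso
          rw [h0, pow_zero, one_mul] at hg
          rw [hg] at hfactor
          omega
        · exact ⟨e - 1, by omega⟩
      have hn : n = (((2 : ℕ) : ℤ) ^ k) ^ 2 * (g ^ 2 * d₀) := by
        have : (4 : ℤ) * n = 4 * ((((2 : ℕ) : ℤ) ^ k) ^ 2 * (g ^ 2 * d₀)) := by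
          rw [hfactor, hg, hk]
          push_cast
          ring
        linarith
      rw [hn, hk, add_comm k 1]
      refine HasConductor.prime_pow_sq_mul hp ?_ k
      split_ifs with h1 h5
      · exact_mod_cast hasConductor_two_of_mod_eight_eq_one (hmod.trans h1)
      · exact_mod_cast hasConductor_two_of_mod_eight_eq_five (hmod.trans h5)
      · omega
    · have hmod : ((g : ℤ) ^ 2 * m) % 4 = m % 4 := by
        rw [Int.mul_emod, show (g : ℤ) ^ 2 % 4 = 1 by omega]
        simp
      rw [if_neg (by omega), if_neg (by omega)]
      have hn : n = (((2 : ℕ) : ℤ) ^ e) ^ 2 * (g ^ 2 * m) := by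
        have : (4 : ℤ) * n = 4 * ((((2 : ℕ) : ℤ) ^ e) ^ 2 * (g ^ 2 * m)) := by
          rw [hfactor, hg]
          push_cast
          ring
        linarith
      rw [hn]
      conv => arg 4; rw [← zero_add e]
      refine HasConductor.prime_pow_sq_mul hp ?_ e
      push_cast
      rcases hm with hm | hm
      · refine hasConductor_of_prime_exactly_dvd hp ?_ ?_ <;> (push_cast; omega)
      · exact hasConductor_two_of_mod_four_eq_three (by omega)
  · have hpg' : ¬ (p : ℤ) ∣ g := by exact_mod_cast hpg
    have hcop4 : IsCoprime (((p : ℤ) ^ e) ^ 2) 4 := by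
      have h1 : IsCoprime ((p : ℕ) : ℤ) ((2 : ℕ) : ℤ) :=
        Nat.isCoprime_iff_coprime.2 ((Nat.coprime_primes hp Nat.prime_two).2 hp2)
      have := (h1.pow_right (n := 2)).pow_left (m := e) |>.pow_left (m := 2)
      simpa using this
    obtain ⟨m, hm⟩ : ((p : ℤ) ^ e) ^ 2 ∣ n := by
      refine hcop4.dvd_of_dvd_mul_left ⟨g ^ 2 * d₀, ?_⟩
      rw [hfactor, hg]
      push_cast
      ring
    have h4m : 4 * m = (g : ℤ) ^ 2 * d₀ := by
      have h0 : ((p : ℤ) ^ e) ^ 2 ≠ 0 := pow_ne_zero _ (pow_ne_zero _ hpi.ne_zero)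
      refine mul_left_cancel₀ h0 ?_
      have h1 : 4 * n = ((p : ℤ) ^ e) ^ 2 * (4 * m) := by rw [hm]; ring
      rw [← h1, hfactor, hg]
      push_cast
      ring
    have hdm : (p : ℤ) ∣ m ↔ (p : ℤ) ∣ d₀ := by
      have hp4 : ¬ (p : ℤ) ∣ 4 := by
        intro h
        have h' : p ∣ 2 ^ 2 := by exact_mod_cast h
        exact hp2 ((Nat.prime_dvd_prime_iff_eq hp Nat.prime_two).1 (hp.dvd_of_dvd_pow h'))
      constructor
      · intro h
        have h' : (p : ℤ) ∣ (g : ℤ) ^ 2 * d₀ := h4m ▸ h.mul_left 4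
        exact (hpi.dvd_or_dvd h').resolve_left fun h => hpg' (hpi.dvd_of_dvd_pow h)
      · intro h
        have h' : (p : ℤ) ∣ 4 * m := h4m ▸ h.mul_left _
        exact (hpi.dvd_or_dvd h').resolve_left hp4
    rw [hm]
    conv => arg 4; rw [← zero_add e]
    refine HasConductor.prime_pow_sq_mul hp ?_ e
    simp only [kroneckerChi, if_neg hp2]
    split_ifs with h1 h2
    · push_cast
      refine hasConductor_of_prime_exactly_dvd hp (hdm.2 h1) fun h => hfund.not_sq_dvd hp hp2 ?_
      refine ((hpi.coprime_iff_not_dvd.2 hpg').pow (m := 2) (n := 2)).dvd_of_dvd_mul_left ?_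
      rw [← h4m]
      exact h.mul_left 4
    · exact_mod_cast hasConductor_of_isSquare hp hp2 (hdm.not.2 h1)
        ((Int.isSquare_cast_iff_of_sq_mul hp hp2 hpg' h4m).2 h2)
    · exact_mod_cast hasConductor_of_not_isSquare
        ((Int.isSquare_cast_iff_of_sq_mul hp hp2 hpg' h4m).not.2 h2)

section ConductorFn
open PowerSeries

/-- The multiplicative arithmetic function with `F p k` as its value at `p ^ k`. -/
noncomputable def ofPrimePow (F : ℕ → ℕ → ℝ) : ArithmeticFunction ℝ where
  toFun m := if m = 0 then 0 else m.factorization.prod F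
  map_zero' := by simp

lemma ofPrimePow_prime_pow {F : ℕ → ℕ → ℝ} {p : ℕ} (hp : p.Prime) (hF : F p 0 = 1) (k : ℕ) :
    ofPrimePow F (p ^ k) = F p k := by
  simp [ofPrimePow, hp.ne_zero, hp.factorization_pow, Finsupp.prod_single_index, hF]

lemma isMultiplicative_ofPrimePow (F : ℕ → ℕ → ℝ) : (ofPrimePow F).IsMultiplicative := by
  rw [ArithmeticFunction.IsMultiplicative.iff_ne_zero]
  refine ⟨by simp [ofPrimePow], fun {m n} hm hn h => ?_⟩
  simp only [ofPrimePow, ArithmeticFunction.coe_mk, if_neg hm, if_neg hn,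
    if_neg (mul_ne_zero hm hn)]
  rw [Nat.factorization_mul hm hn, Finsupp.prod_add_index_of_disjoint]
  simpa using h.disjoint_primeFactors

lemma ofPrimePow_eq_zero {F : ℕ → ℕ → ℝ} {m p : ℕ} (hp : p ∈ m.primeFactors)
    (hF : F p (m.factorization p) = 0) : ofPrimePow F m = 0 := by
  have hm : m ≠ 0 := by
    rintro rfl
    simp at hp
  simp only [ofPrimePow, ArithmeticFunction.coe_mk, if_neg hm]
  exact Finset.prod_eq_zero (by simpa using hp) hF

lemma constantCoeff_conductorSeries (χ c : ℝ) (e : ℕ) :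
    coeff 0 (conductorSeries χ c e) = 1 := by
  cases e <;> simp [conductorSeries]

/-- The arithmetic function by which square root counts change for conductor `f`. -/
noncomputable def conductorFn (χ : ℕ → ℝ) (f : ℕ) : ArithmeticFunction ℝ :=
  ofPrimePow fun p k => coeff k (conductorSeries (χ p) p (f.factorization p))

lemma localSeries_conductorFn (χ : ℕ → ℝ) (f : ℕ) {p : ℕ} (hp : p.Prime) :
    localSeries p (conductorFn χ f) = conductorSeries (χ p) p (f.factorization p) := by
  ext k
  rw [localSeries, coeff_mk, conductorFn,
    ofPrimePow_prime_pow hp (constantCoeff_conductorSeries _ _ _)]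

/-- The value of `conductorSeries χ c e` at `x`. -/
noncomputable def conductorEval (χ c x : ℝ) : ℕ → ℝ
  | 0 => 1
  | e + 1 => 1 - χ * x + c * x ^ 2 * conductorEval χ c x e

lemma hasSum_conductorSeries (χ c x : ℝ) (e : ℕ) :
    HasSum (fun k => coeff k (conductorSeries χ c e) * x ^ k) (conductorEval χ c x e) := by
  induction e with
  | zero =>
    have := hasSum_single (f := fun k => coeff k (conductorSeries χ c 0) * x ^ k) 0
      (fun k hk => by simp [conductorSeries, coeff_one, hk])
    simpa [conductorSeries, conductorEval] using this
  | succ e ih =>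
    rw [← hasSum_nat_add_iff' 2]
    have hval : conductorEval χ c x (e + 1)
        - ∑ i ∈ Finset.range 2, coeff i (conductorSeries χ c (e + 1)) * x ^ i
        = c * x ^ 2 * conductorEval χ c x e := by
      have h1 : coeff 1 (C c * X ^ 2 * conductorSeries χ c e) = 0 := by
        rw [mul_assoc, coeff_C_mul, coeff_X_pow_mul', if_neg (by omega), mul_zero]
      have h2 : coeff 1 (C χ * X) = χ := by
        rw [coeff_C_mul, coeff_one_X, mul_one]
      rw [Finset.sum_range_succ, Finset.sum_range_one, constantCoeff_conductorSeries,
        conductorSeries, map_add, map_sub, h1, h2, coeff_one, conductorEval, if_neg one_ne_zero]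
      ring
    rw [hval]
    refine (ih.mul_left (c * x ^ 2)).congr_fun fun k => ?_
    have h1 : coeff (k + 2) (C c * X ^ 2 * conductorSeries χ c e)
        = c * coeff k (conductorSeries χ c e) := by
      rw [mul_assoc, coeff_C_mul, coeff_X_pow_mul]
    have h2 : coeff (k + 2) (C χ * X) = 0 := by
      rw [coeff_C_mul, coeff_X, if_neg (by omega), mul_zero]
    rw [conductorSeries, map_add, map_sub, h1, h2, coeff_one, if_neg (by omega)]
    ring

lemma sigmaOne_prime_pow_succ {p : ℕ} (hp : p.Prime) (e : ℕ) :
    sigmaOne (p ^ (e + 1)) = sigmaOne (p ^ e) + p ^ (e + 1) := by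
  rw [sigmaOne, sigmaOne, Nat.sum_divisors_prime_pow hp, Nat.sum_divisors_prime_pow hp,
    Finset.sum_range_succ]

lemma conductorEval_inv {p : ℕ} (hp : p.Prime) (χ : ℝ) (e : ℕ) :
    conductorEval χ p (p : ℝ)⁻¹ (e + 1)
      = ((sigmaOne (p ^ (e + 1)) : ℝ) - χ * sigmaOne (p ^ e)) / p ^ (e + 1) := by
  have hp0 : (p : ℝ) ≠ 0 := by exact_mod_cast hp.ne_zero
  induction e with
  | zero =>
    rw [sigmaOne_prime_pow_succ hp]
    simp only [conductorEval, zero_add, pow_zero, pow_one, sigmaOne, Nat.divisors_one,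
      Finset.sum_singleton]
    field_simp
    push_cast
    ring
  | succ e ih =>
    rw [conductorEval, ih, sigmaOne_prime_pow_succ hp (e + 1)]
    rw [sigmaOne_prime_pow_succ hp e]
    push_cast
    field_simp
    ring

lemma summable_and_hasSum_conductorFn (χ : ℕ → ℝ) {f : ℕ} (hf : f ≠ 0) :
    (Summable fun m : ℕ => ‖conductorFn χ f m / m‖) ∧
    HasSum (fun m : ℕ => conductorFn χ f m / m)
      ((∏ p ∈ f.primeFactors, ((sigmaOne (p ^ (f.factorization p)) : ℝ) -
        χ p * (sigmaOne (p ^ (f.factorization p - 1)) : ℝ))) / f) := by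
  have hlocal : ∀ {p : ℕ}, p.Prime →
      HasSum (fun k : ℕ => conductorFn χ f (p ^ k) / ((p ^ k : ℕ) : ℝ))
        (conductorEval (χ p) p (p : ℝ)⁻¹ (f.factorization p)) := by
    intro p hp
    refine (hasSum_conductorSeries (χ p) p (p : ℝ)⁻¹ (f.factorization p)).congr_fun ?_
    intro k
    rw [conductorFn, ofPrimePow_prime_pow hp (constantCoeff_conductorSeries _ _ _)]
    push_cast
    rw [inv_pow, div_eq_mul_inv]
  have hsupp : Function.support (fun m : ℕ => conductorFn χ f m / m)
      ⊆ Nat.factoredNumbers f.primeFactors := by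
    intro m hm
    rw [Function.mem_support] at hm
    have hm0 : m ≠ 0 := by
      rintro rfl
      simp at hm
    refine Nat.mem_factoredNumbers_of_primeFactors_subset hm0 fun p hp => ?_
    by_contra hpf
    refine hm ?_
    rw [conductorFn, ofPrimePow_eq_zero hp, zero_div]
    have h0 : f.factorization p = 0 := by
      rw [← Finsupp.notMem_support_iff]
      simpa using hpf
    have hmp : m.factorization p ≠ 0 := by
      rw [← Finsupp.mem_support_iff]
      simpa using hp
    rw [h0, conductorSeries, coeff_one, if_neg hmp]
  obtain ⟨h1, h2⟩ := EulerProduct.summable_and_hasSum_factoredNumbers_prod_filter_prime_tsum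
    (f := fun m : ℕ => conductorFn χ f m / (m : ℝ))
    (by simp [(isMultiplicative_ofPrimePow _).map_one, conductorFn])
    (fun {m n} h => by
      simp only [conductorFn, (isMultiplicative_ofPrimePow _).map_mul_of_coprime h]
      push_cast
      rw [mul_div_mul_comm])
    (fun hp => (hlocal hp).summable.norm) f.primeFactors
  have e1 : ∏ p ∈ f.primeFactors with p.Prime,
      ∑' n : ℕ, conductorFn χ f (p ^ n) / ((p ^ n : ℕ) : ℝ)
      = (∏ p ∈ f.primeFactors, ((sigmaOne (p ^ (f.factorization p)) : ℝ) -
        χ p * (sigmaOne (p ^ (f.factorization p - 1)) : ℝ))) / f := by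
    have hfp : (f : ℝ) = ∏ p ∈ f.primeFactors, (p : ℝ) ^ f.factorization p := by
      conv_lhs => rw [← Nat.prod_factorization_pow_eq_self hf]
      rw [Finsupp.prod]
      push_cast
      rfl
    rw [Finset.filter_true_of_mem fun p hp => Nat.prime_of_mem_primeFactors hp]
    conv_rhs => rw [hfp]
    rw [← Finset.prod_div_distrib]
    refine Finset.prod_congr rfl fun p hp => ?_
    have hpp := Nat.prime_of_mem_primeFactors hp
    rw [(hlocal hpp).tsum_eq]
    have hpos := hpp.factorization_pos_of_dvd hf (Nat.dvd_of_mem_primeFactors hp)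
    obtain ⟨e, he⟩ : ∃ e, f.factorization p = e + 1 := ⟨f.factorization p - 1, by omega⟩
    rw [he, conductorEval_inv hpp, Nat.add_sub_cancel]
  rw [e1] at h2
  have h3 := (hasSum_subtype_iff_of_support_subset hsupp).1 h2
  exact ⟨h3.summable.norm, h3⟩

end ConductorFn

section IdealCount
open NumberField

/-- The number of integral ideals of norm `m`, for `m ≠ 0`. -/
noncomputable def idealCountFn (K : Type*) [Field K] [NumberField K] : ArithmeticFunction ℝ where
  toFun m := if m = 0 then 0 else (Nat.card {I : Ideal (𝓞 K) // Ideal.absNorm I = m} : ℝ)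
  map_zero' := by simp

variable {K : Type*} [Field K] [NumberField K]

lemma idealCountFn_apply {m : ℕ} (hm : m ≠ 0) :
    idealCountFn K m = ({I : Ideal (𝓞 K) | Ideal.absNorm I = m}.ncard : ℝ) := by
  simp only [idealCountFn, ArithmeticFunction.coe_mk, if_neg hm]
  rfl

lemma idealCountFn_one : idealCountFn K 1 = 1 := by
  rw [idealCountFn_apply one_ne_zero]
  simp [Ideal.absNorm_eq_one_iff]

lemma isCoprime_of_coprime_absNorm {I J : Ideal (𝓞 K)}
    (h : (Ideal.absNorm I).Coprime (Ideal.absNorm J)) : IsCoprime I J := by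
  rw [Ideal.isCoprime_iff_sup_eq, ← Ideal.absNorm_eq_one_iff]
  exact Nat.eq_one_of_dvd_coprimes h (Ideal.absNorm_dvd_absNorm_of_le le_sup_left)
    (Ideal.absNorm_dvd_absNorm_of_le le_sup_right)

lemma Ideal.eq_of_dvd_of_absNorm_eq {I J : Ideal (𝓞 K)} (h : I ∣ J)
    (hn : Ideal.absNorm I = Ideal.absNorm J) (h0 : Ideal.absNorm I ≠ 0) : I = J := by
  obtain ⟨A, rfl⟩ := h
  rw [map_mul] at hn
  have hA : Ideal.absNorm A = 1 := by
    have := Nat.eq_of_mul_eq_mul_left (Nat.pos_of_ne_zero h0) ((mul_one _).trans hn)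
    exact this.symm
  rw [Ideal.absNorm_eq_one_iff.1 hA, Ideal.mul_top]

lemma exists_mul_eq_of_absNorm_eq_mul {m n : ℕ} (h : m.Coprime n) (hm : m ≠ 0) (hn : n ≠ 0)
    {L : Ideal (𝓞 K)} (hL : Ideal.absNorm L = m * n) :
    ∃ I J : Ideal (𝓞 K), Ideal.absNorm I = m ∧ Ideal.absNorm J = n ∧ I * J = L := by
  have hmem : (m : 𝓞 K) * n ∈ L := by
    have := Ideal.absNorm_mem L
    rwa [hL, Nat.cast_mul] at this
  have hcop : Ideal.span {(m : 𝓞 K)} ⊔ Ideal.span {(n : 𝓞 K)} = ⊤ := by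
    rw [← Ideal.isCoprime_iff_sup_eq, Ideal.isCoprime_span_singleton_iff]
    exact h.cast
  set I := L ⊔ Ideal.span {(m : 𝓞 K)} with hI
  set J := L ⊔ Ideal.span {(n : 𝓞 K)} with hJ
  have hmul : I * J = L := by
    rw [hI, hJ, Ideal.sup_mul, Ideal.mul_sup, Ideal.mul_sup]
    refine le_antisymm ?_ ?_
    · refine sup_le (sup_le Ideal.mul_le_right Ideal.mul_le_left)
        (sup_le Ideal.mul_le_right ?_)
      rw [Ideal.span_singleton_mul_span_singleton, Ideal.span_singleton_le_iff_mem]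
      exact hmem
    · calc L = L * Ideal.span {(n : 𝓞 K)} ⊔ Ideal.span {(m : 𝓞 K)} * L := by
            rw [mul_comm _ L, ← Ideal.mul_sup, sup_comm, hcop, Ideal.mul_top]
        _ ≤ _ := sup_le (le_sup_right.trans le_sup_left) (le_sup_left.trans le_sup_right)
  have hmulN : Ideal.absNorm I * Ideal.absNorm J = m * n := by rw [← map_mul, hmul, hL]
  have hIm : Ideal.absNorm I ∣ m := by
    have h1 : Ideal.absNorm I ∣ m ^ Module.finrank ℤ (𝓞 K) := by
      rw [← Ideal.absNorm_span_natCast]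
      exact Ideal.absNorm_dvd_absNorm_of_le le_sup_right
    exact ((h.pow_left _).coprime_dvd_left h1).dvd_of_dvd_mul_right (Dvd.intro _ hmulN)
  have hJn : Ideal.absNorm J ∣ n := by
    have h1 : Ideal.absNorm J ∣ n ^ Module.finrank ℤ (𝓞 K) := by
      rw [← Ideal.absNorm_span_natCast]
      exact Ideal.absNorm_dvd_absNorm_of_le le_sup_right
    exact ((h.symm.pow_left _).coprime_dvd_left h1).dvd_of_dvd_mul_left (Dvd.intro_left _ hmulN)
  obtain ⟨a, ha⟩ := hIm
  obtain ⟨b, hb⟩ := hJn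
  have hab : a * b = 1 := by
    have h0 : Ideal.absNorm I * Ideal.absNorm J ≠ 0 := hmulN ▸ mul_ne_zero hm hn
    refine Nat.eq_of_mul_eq_mul_left (Nat.pos_of_ne_zero h0) ?_
    calc Ideal.absNorm I * Ideal.absNorm J * (a * b)
        = (Ideal.absNorm I * a) * (Ideal.absNorm J * b) := by ring
      _ = _ := by rw [← ha, ← hb, hmulN, mul_one]
  have ha1 := Nat.eq_one_of_mul_eq_one_right hab
  have hb1 := Nat.eq_one_of_mul_eq_one_left hab
  rw [ha1, mul_one] at ha
  rw [hb1, mul_one] at hb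
  exact ⟨I, J, ha.symm, hb.symm, hmul⟩

lemma isMultiplicative_idealCountFn : (idealCountFn K).IsMultiplicative := by
  rw [ArithmeticFunction.IsMultiplicative.iff_ne_zero]
  refine ⟨idealCountFn_one, fun {m n} hm hn h => ?_⟩
  rw [idealCountFn_apply hm, idealCountFn_apply hn, idealCountFn_apply (mul_ne_zero hm hn),
    ← Nat.cast_mul, ← Set.ncard_prod, Nat.cast_inj]
  symm
  refine Set.ncard_congr (fun x _ => x.1 * x.2) ?_ ?_ ?_
  · rintro ⟨I, J⟩ ⟨hI, hJ⟩
    simp only [Set.mem_ofPred_eq] at hI hJ ⊢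
    rw [map_mul, hI, hJ]
  · rintro ⟨I, J⟩ ⟨I', J'⟩ ⟨hI, hJ⟩ ⟨hI', hJ'⟩ he
    simp only [Set.mem_ofPred_eq] at hI hJ hI' hJ' he
    refine Prod.ext ?_ ?_
    · refine Ideal.eq_of_dvd_of_absNorm_eq ?_ (hI.trans hI'.symm) (hI ▸ hm)
      refine (isCoprime_of_coprime_absNorm (J := J') ?_).dvd_of_dvd_mul_right (Dvd.intro _ he)
      rwa [hI, hJ']
    · refine Ideal.eq_of_dvd_of_absNorm_eq ?_ (hJ.trans hJ'.symm) (hJ ▸ hn)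
      refine (isCoprime_of_coprime_absNorm (J := I') ?_).dvd_of_dvd_mul_left (Dvd.intro_left _ he)
      rw [hI', hJ]
      exact h.symm
  · intro L hL
    obtain ⟨I, J, hI, hJ, hIJ⟩ := exists_mul_eq_of_absNorm_eq_mul h hm hn hL
    exact ⟨(I, J), ⟨hI, hJ⟩, hIJ⟩

lemma tendsto_mean_idealCountFn :
    Tendsto (fun N : ℕ => (∑ m ∈ Finset.Ioc 0 N, idealCountFn K m) / N) atTop
      (nhds (dedekindZeta_residue K)) := by
  refine ((Ideal.tendsto_norm_le_div_atTop₀ K).comp tendsto_natCast_atTop_atTop).congr fun n => ?_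
  have h1 : ∑ m ∈ Finset.Ioc 0 n, idealCountFn K m
      = ((∑ m ∈ Finset.Ioc 0 n, Nat.card {I : Ideal (𝓞 K) // Ideal.absNorm I = m} : ℕ) : ℝ) := by
    rw [Nat.cast_sum]
    refine Finset.sum_congr rfl fun m hm => ?_
    simp only [idealCountFn, ArithmeticFunction.coe_mk,
      if_neg (Finset.mem_Ioc.1 hm).1.ne']
  rw [h1]
  simp only [Function.comp_apply, Nat.cast_le]
  congr
  rw [← add_left_inj 1, ← Ideal.card_norm_le_eq_card_norm_le_add_one,
    show 1 = Nat.card {I : Ideal (𝓞 K) // Ideal.absNorm I = 0} by simp [Ideal.absNorm_eq_zero_iff],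
    Finset.sum_Ioc_add_eq_sum_Icc (n.zero_le),
    ← Finset.card_preimage_eq_sum_card_image_eq (fun k _ ↦ Ideal.finite_setOfPred_absNorm_eq k)]
  simp [Set.coe_eq_subtype]

lemma nrComplexPlaces_eq_zero_of_real_quadratic (hdeg : Module.finrank ℚ K = 2)
    (hd : 0 < discr K) : InfinitePlace.nrComplexPlaces K = 0 := by
  have h1 := InfinitePlace.card_add_two_mul_card_eq_rank K
  have h2 := sign_discr K
  rw [Int.sign_eq_one_of_pos hd] at h2
  rw [hdeg] at h1
  rcases Nat.lt_or_ge (InfinitePlace.nrComplexPlaces K) 1 with h | h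
  · omega
  · rw [show InfinitePlace.nrComplexPlaces K = 1 by omega] at h2
    norm_num at h2

lemma torsionOrder_eq_two_of_nrRealPlaces_pos (h : 0 < InfinitePlace.nrRealPlaces K) :
    Units.torsionOrder K = 2 := by
  classical
  have key : ∀ x : Units.torsion K, (x : (𝓞 K)ˣ) = 1 ∨ (x : (𝓞 K)ˣ) = -1 := by
    intro x
    obtain ⟨k, hk, hxk⟩ := isOfFinOrder_iff_pow_eq_one.1 ((CommGroup.mem_torsion x.1).1 x.2)
    set ξ : K := algebraMap (𝓞 K) K (x : (𝓞 K)ˣ) with hξ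
    have hfin : IsOfFinOrder ξ := isOfFinOrder_iff_pow_eq_one.2 ⟨k, hk, by
      rw [hξ, ← map_pow, ← Units.val_pow_eq_pow_val, hxk, Units.val_one, map_one]⟩
    have hle : orderOf ξ ≤ 2 := by
      by_contra! hc
      exact h.ne' (InfinitePlace.IsPrimitiveRoot.nrRealPlaces_eq_zero_of_two_lt hc
        (IsPrimitiveRoot.orderOf ξ))
    have hsq : ξ ^ 2 = 1 := by
      rw [← orderOf_dvd_iff_pow_eq_one]
      have hpos := hfin.orderOf_pos
      interval_cases orderOf ξ
      exacts [one_dvd _, dvd_rfl]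
    refine (sq_eq_one_iff.1 hsq).imp (fun h1 => ?_) (fun h1 => ?_)
    all_goals
      refine Units.ext (RingOfIntegers.coe_injective ?_)
      simpa [hξ] using h1
  let := Fintype.ofFinite (Units.torsion K)
  rw [Units.torsionOrder, Nat.card_eq_fintype_card]
  refine (Finset.card_eq_two.2 ⟨1, ⟨-1, (CommGroup.mem_torsion _).2 (isOfFinOrder_iff_pow_eq_one.2 ⟨2, by norm_num, by simp⟩)⟩,
    by simp [← Subtype.coe_ne_coe], Finset.ext fun x ↦ ⟨fun _ ↦ ?_, fun _ ↦ Finset.mem_univ _⟩⟩)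
  rw [Finset.mem_insert, Finset.mem_singleton, ← Subtype.val_inj, ← Subtype.val_inj]
  exact key x

lemma dedekindZeta_residue_of_real_quadratic (hdeg : Module.finrank ℚ K = 2)
    (hd : 0 < discr K) : dedekindZeta_residue K
      = 2 * Units.regulator K * classNumber K / √(discr K : ℝ) := by
  have h0 := nrComplexPlaces_eq_zero_of_real_quadratic hdeg hd
  have h1 := InfinitePlace.card_add_two_mul_card_eq_rank K
  have h2 : InfinitePlace.nrRealPlaces K = 2 := by omega
  rw [dedekindZeta_residue_def, h0, h2, torsionOrder_eq_two_of_nrRealPlaces_pos (by omega),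
    abs_of_pos (by exact_mod_cast hd : (0 : ℝ) < discr K)]
  push_cast
  rw [pow_zero]
  ring

end IdealCount

section LocalFactor
open NumberField

lemma mk_mul_eq_one_of_recurrence {a : ℕ → ℝ} {c : ℝ} (h0 : a 0 = 1) (h1 : a 1 = 1 + c)
    (h : ∀ k, a (k + 2) = (1 + c) * a (k + 1) - c * a k) :
    (PowerSeries.mk a) * ((1 - PowerSeries.X) * (1 - PowerSeries.C c * PowerSeries.X)) = 1 := by
  have e : (PowerSeries.mk a) * ((1 - PowerSeries.X) * (1 - PowerSeries.C c * PowerSeries.X))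
      = PowerSeries.mk a - PowerSeries.C (1 + c) * (PowerSeries.X * PowerSeries.mk a)
        + PowerSeries.C c * (PowerSeries.X * (PowerSeries.X * PowerSeries.mk a)) := by
    rw [map_add, map_one]
    ring
  rw [e]
  generalize 1 + c = s at h1 h ⊢
  ext k
  rcases k with _ | _ | k
  · simp [h0]
  · simp [PowerSeries.coeff_succ_X_mul, PowerSeries.coeff_one, h0, h1]
  · simp [PowerSeries.coeff_succ_X_mul, PowerSeries.coeff_one, h k]

variable {K : Type*} [Field K] [NumberField K]

/-- The ideals of norm `q` divisible by `M`. -/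
def idealsDvd (M : Ideal (𝓞 K)) (q : ℕ) : Set (Ideal (𝓞 K)) :=
  {I | Ideal.absNorm I = q ∧ M ∣ I}

lemma finite_idealsDvd (M : Ideal (𝓞 K)) (q : ℕ) : (idealsDvd M q).Finite :=
  (Ideal.finite_setOfPred_absNorm_eq q).subset fun _ h => h.1

lemma ncard_idealsDvd {M : Ideal (𝓞 K)} {m q : ℕ} (hM : Ideal.absNorm M = q) (hq : q ≠ 0)
    (hm : m ≠ 0) : ((idealsDvd M (q * m)).ncard : ℝ) = idealCountFn K m := by
  have hM0 : M ≠ 0 := by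
    rintro rfl
    exact hq (by simpa using hM.symm)
  rw [idealCountFn_apply hm, Nat.cast_inj,
    ← Set.ncard_image_of_injective {J | Ideal.absNorm J = m} (mul_right_injective₀ hM0)]
  congr 1
  ext I
  simp only [idealsDvd, Set.mem_ofPred_eq, Set.mem_image]
  constructor
  · rintro ⟨hI, J, rfl⟩
    rw [map_mul, hM] at hI
    exact ⟨J, Nat.eq_of_mul_eq_mul_left (Nat.pos_of_ne_zero hq) hI, rfl⟩
  · rintro ⟨J, hJ, rfl⟩
    exact ⟨by rw [map_mul, hM, hJ], Dvd.intro _ rfl⟩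

lemma exists_isMaximal_dvd_span_of_dvd_absNorm {p : ℕ} (hp : p.Prime) {I : Ideal (𝓞 K)}
    (h : p ∣ Ideal.absNorm I) :
    ∃ M : Ideal (𝓞 K), M.IsMaximal ∧ M ∣ Ideal.span {(p : 𝓞 K)} ∧ M ∣ I := by
  obtain ⟨M, hM, hMp, hMI⟩ := Ideal.exists_isMaximal_dvd_of_dvd_absNorm' hp I h
  refine ⟨M, hM, ?_, hMI⟩
  rw [Ideal.dvd_iff_le, Ideal.span_singleton_le_iff_mem]
  have h1 : (p : ℤ) ∈ M.under ℤ := by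
    rw [hMp]
    exact Ideal.mem_span_singleton_self _
  simpa [Ideal.under_def, Ideal.mem_comap] using h1

lemma absNorm_span_natCast_of_quadratic (hdeg : Module.finrank ℚ K = 2) (p : ℕ) :
    Ideal.absNorm (Ideal.span {(p : 𝓞 K)}) = p ^ 2 := by
  rw [Ideal.absNorm_span_natCast, RingOfIntegers.rank, hdeg]

lemma localSeries_idealCountFn_of_isPrime (hdeg : Module.finrank ℚ K = 2) {p : ℕ} (hp : p.Prime)
    (h : (Ideal.span {(p : 𝓞 K)}).IsPrime) :
    localSeries p (idealCountFn K)
      * ((1 - PowerSeries.X) * (1 - PowerSeries.C (-1) * PowerSeries.X)) = 1 := by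
  have hN := absNorm_span_natCast_of_quadratic hdeg p
  have hmax : (Ideal.span {(p : 𝓞 K)}).IsMaximal := h.isMaximal (by
    simpa using hp.ne_zero)
  have hdvd : ∀ I : Ideal (𝓞 K), p ∣ Ideal.absNorm I → Ideal.span {(p : 𝓞 K)} ∣ I := by
    intro I hI
    obtain ⟨M, hM, hMp, hMI⟩ := exists_isMaximal_dvd_span_of_dvd_absNorm hp hI
    rwa [hmax.eq_of_le hM.ne_top (Ideal.dvd_iff_le.1 hMp)]
  refine mk_mul_eq_one_of_recurrence ?_ ?_ fun k => ?_
  · rw [pow_zero, idealCountFn_one]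
  · rw [pow_one, idealCountFn_apply hp.ne_zero, add_neg_cancel, Nat.cast_eq_zero]
    rw [Set.ncard_eq_zero (Ideal.finite_setOfPred_absNorm_eq p)]
    refine Set.eq_empty_of_forall_notMem fun (I : Ideal (𝓞 K)) (hI : Ideal.absNorm I = p) => ?_
    have h1 := map_dvd (Ideal.absNorm (S := 𝓞 K)) (hdvd I hI.symm.dvd)
    rw [hN, hI] at h1
    have h2 := Nat.le_of_dvd hp.pos h1
    nlinarith [hp.two_le]
  · have hp0 := pow_ne_zero k hp.ne_zero
    rw [← ncard_idealsDvd hN (pow_ne_zero 2 hp.ne_zero) hp0, ← pow_add, add_comm 2 k,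
      idealCountFn_apply (pow_ne_zero _ hp.ne_zero)]
    simp only [neg_mul, one_mul, add_neg_cancel, zero_mul, sub_neg_eq_add, zero_add]
    congr 2
    ext I
    simp only [idealsDvd, Set.mem_ofPred_eq]
    refine ⟨fun hI => ⟨hI, hdvd I ?_⟩, And.left⟩
    rw [hI]
    exact dvd_pow_self p (by omega)

lemma eq_or_eq_of_isMaximal_dvd_mul {p : ℕ} (hp : p.Prime) {P Q M : Ideal (𝓞 K)}
    (hP : Ideal.absNorm P = p) (hQ : Ideal.absNorm Q = p) (hM : M.IsMaximal) (h : M ∣ P * Q) :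
    M = P ∨ M = Q := by
  have key : ∀ R : Ideal (𝓞 K), Ideal.absNorm R = p → R ≤ M → M = R := by
    intro R hR hRM
    have : R.IsPrime := Ideal.isPrime_of_irreducible_absNorm (by rw [hR]; exact hp)
    have hR0 : R ≠ ⊥ := by
      rintro rfl
      exact hp.ne_zero (by simpa using hR.symm)
    exact ((this.isMaximal hR0).eq_of_le hM.ne_top hRM).symm
  exact (hM.isPrime.mul_le.1 (Ideal.dvd_iff_le.1 h)).imp (key P hP) (key Q hQ)

lemma dvd_or_dvd_of_dvd_absNorm {p : ℕ} (hp : p.Prime) {P Q I : Ideal (𝓞 K)}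
    (hP : Ideal.absNorm P = p) (hQ : Ideal.absNorm Q = p) (hPQ : P * Q = Ideal.span {(p : 𝓞 K)})
    (hI : p ∣ Ideal.absNorm I) : P ∣ I ∨ Q ∣ I := by
  obtain ⟨M, hM, hMp, hMI⟩ := exists_isMaximal_dvd_span_of_dvd_absNorm hp hI
  rw [← hPQ] at hMp
  rcases eq_or_eq_of_isMaximal_dvd_mul hp hP hQ hM hMp with rfl | rfl
  exacts [Or.inl hMI, Or.inr hMI]

lemma localSeries_idealCountFn_of_sq {p : ℕ} (hp : p.Prime) {P : Ideal (𝓞 K)}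
    (hP : Ideal.absNorm P = p) (h : P * P = Ideal.span {(p : 𝓞 K)}) :
    localSeries p (idealCountFn K)
      * ((1 - PowerSeries.X) * (1 - PowerSeries.C 0 * PowerSeries.X)) = 1 := by
  have step : ∀ k, idealCountFn K (p ^ (k + 1)) = idealCountFn K (p ^ k) := by
    intro k
    rw [← ncard_idealsDvd hP hp.ne_zero (pow_ne_zero k hp.ne_zero), ← pow_succ',
      idealCountFn_apply (pow_ne_zero _ hp.ne_zero)]
    congr 2
    ext I
    simp only [idealsDvd, Set.mem_ofPred_eq]
    refine ⟨fun hI => ⟨hI, ?_⟩, And.left⟩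
    refine or_self_iff.1 (dvd_or_dvd_of_dvd_absNorm hp hP hP h ?_)
    rw [hI]
    exact dvd_pow_self p (by omega)
  refine mk_mul_eq_one_of_recurrence ?_ ?_ fun k => ?_
  · rw [pow_zero, idealCountFn_one]
  · rw [step 0, pow_zero, idealCountFn_one, add_zero]
  · rw [step (k + 1)]
    ring

lemma isCoprime_of_absNorm_eq_prime {p : ℕ} (hp : p.Prime) {P Q : Ideal (𝓞 K)} (hne : P ≠ Q)
    (hP : Ideal.absNorm P = p) (hQ : Ideal.absNorm Q = p) : IsCoprime P Q := by
  have key : ∀ R : Ideal (𝓞 K), Ideal.absNorm R = p → R.IsMaximal := by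
    intro R hR
    refine (Ideal.isPrime_of_irreducible_absNorm (by rw [hR]; exact hp)).isMaximal ?_
    rintro rfl
    exact hp.ne_zero (by simpa using hR.symm)
  exact Ideal.isCoprime_iff_sup_eq.2 ((key P hP).coprime_of_ne (key Q hQ) hne)

lemma localSeries_idealCountFn_of_ne {p : ℕ} (hp : p.Prime) {P Q : Ideal (𝓞 K)} (hne : P ≠ Q)
    (hP : Ideal.absNorm P = p) (hQ : Ideal.absNorm Q = p) (h : P * Q = Ideal.span {(p : 𝓞 K)}) :
    localSeries p (idealCountFn K)
      * ((1 - PowerSeries.X) * (1 - PowerSeries.C 1 * PowerSeries.X)) = 1 := by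
  have hcop := isCoprime_of_absNorm_eq_prime hp hne hP hQ
  have union : ∀ k, {I : Ideal (𝓞 K) | Ideal.absNorm I = p ^ (k + 1)}
      = idealsDvd P (p ^ (k + 1)) ∪ idealsDvd Q (p ^ (k + 1)) := by
    intro k
    ext I
    simp only [idealsDvd, Set.mem_ofPred_eq, Set.mem_union, ← and_or_left]
    refine ⟨fun hI => ⟨hI, dvd_or_dvd_of_dvd_absNorm hp hP hQ h ?_⟩, And.left⟩
    rw [hI]
    exact dvd_pow_self p (by omega)
  have inter : ∀ q, idealsDvd P q ∩ idealsDvd Q q = idealsDvd (P * Q) q := by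
    intro q
    ext I
    simp only [idealsDvd, Set.mem_ofPred_eq, Set.mem_inter_iff]
    exact ⟨fun hI => ⟨hI.1.1, hcop.mul_dvd hI.1.2 hI.2.2⟩, fun hI =>
      ⟨⟨hI.1, (dvd_mul_right P Q).trans hI.2⟩, hI.1, (dvd_mul_left Q P).trans hI.2⟩⟩
  have count : ∀ k, idealCountFn K (p ^ (k + 1)) + (idealsDvd (P * Q) (p ^ (k + 1))).ncard
      = 2 * idealCountFn K (p ^ k) := by
    intro k
    rw [idealCountFn_apply (pow_ne_zero _ hp.ne_zero), union, ← inter, ← Nat.cast_add,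
      Set.ncard_union_add_ncard_inter _ _ (finite_idealsDvd _ _) (finite_idealsDvd _ _),
      Nat.cast_add, pow_succ', ncard_idealsDvd hP hp.ne_zero (pow_ne_zero _ hp.ne_zero),
      ncard_idealsDvd hQ hp.ne_zero (pow_ne_zero _ hp.ne_zero), two_mul]
  have hN : Ideal.absNorm (P * Q) = p ^ 2 := by rw [map_mul, hP, hQ, sq]
  refine mk_mul_eq_one_of_recurrence ?_ ?_ fun k => ?_
  · rw [pow_zero, idealCountFn_one]
  · have h1 := count 0
    have h2 : idealsDvd (P * Q) (p ^ (0 + 1)) = ∅ := by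
      refine Set.eq_empty_of_forall_notMem fun I hI => ?_
      have h3 := map_dvd Ideal.absNorm hI.2
      rw [hN, hI.1, zero_add, pow_one] at h3
      have h4 := Nat.le_of_dvd hp.pos h3
      nlinarith [hp.two_le]
    rw [h2, pow_zero, idealCountFn_one] at h1
    norm_num at h1 ⊢
    exact h1
  · have h1 := count (k + 1)
    rw [show p ^ (k + 1 + 1) = p ^ 2 * p ^ k by ring,
      ncard_idealsDvd hN (pow_ne_zero 2 hp.ne_zero) (pow_ne_zero k hp.ne_zero)] at h1
    rw [show p ^ (k + 2) = p ^ 2 * p ^ k by ring]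
    linarith

/-- A rational prime is inert, ramified or split in a quadratic field. -/
lemma isPrime_or_exists_mul_eq_span (hdeg : Module.finrank ℚ K = 2) {p : ℕ} (hp : p.Prime) :
    (Ideal.span {(p : 𝓞 K)}).IsPrime ∨ ∃ P Q : Ideal (𝓞 K), Ideal.absNorm P = p ∧
      Ideal.absNorm Q = p ∧ P * Q = Ideal.span {(p : 𝓞 K)} := by
  have hN := absNorm_span_natCast_of_quadratic hdeg p
  obtain ⟨M, hM, ⟨Q, hQ⟩, -⟩ := exists_isMaximal_dvd_span_of_dvd_absNorm (K := K) hp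
    (I := Ideal.span {(p : 𝓞 K)}) (by rw [hN]; exact dvd_pow_self p two_ne_zero)
  have hmul : Ideal.absNorm M * Ideal.absNorm Q = p ^ 2 := by rw [← map_mul, ← hQ, hN]
  obtain ⟨i, hi, hMi⟩ := (Nat.dvd_prime_pow hp).1 (Dvd.intro _ hmul)
  have hM1 : Ideal.absNorm M ≠ 1 := fun h => hM.ne_top (Ideal.absNorm_eq_one_iff.1 h)
  interval_cases i
  · exact absurd hMi (by simpa using hM1)
  · rw [pow_one] at hMi
    refine Or.inr ⟨M, Q, hMi, ?_, hQ.symm⟩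
    rw [hMi, sq] at hmul
    exact Nat.eq_of_mul_eq_mul_left hp.pos hmul
  · left
    rw [← Ideal.eq_of_dvd_of_absNorm_eq (Dvd.intro _ hQ.symm) (hMi.trans hN.symm)
      (by rw [hMi]; exact pow_ne_zero _ hp.ne_zero)]
    exact hM.isPrime

end LocalFactor

section QuadraticSplitting
open NumberField

variable {K : Type*} [Field K] [NumberField K]

lemma intCast_dvd_intCast_ringOfIntegers (hdeg : Module.finrank ℚ K = 2) {a b : ℤ}
    (h : (a : 𝓞 K) ∣ b) : a ∣ b := by
  have h1 := map_dvd (Algebra.norm ℤ (S := 𝓞 K)) h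
  have h2 : ∀ c : ℤ, Algebra.norm ℤ (c : 𝓞 K) = c ^ 2 := fun c => by
    have := Algebra.norm_algebraMap (R := ℤ) (S := 𝓞 K) c
    rw [RingOfIntegers.rank, hdeg] at this
    simpa using this
  rw [h2, h2] at h1
  exact (Int.pow_dvd_pow_iff two_ne_zero).1 h1

lemma exists_galois_involution (hdeg : Module.finrank ℚ K = 2) :
    ∃ σ : Gal(K/ℚ), (∀ x, σ (σ x) = x) ∧
      ∀ x : K, algebraMap ℚ K (Algebra.trace ℚ K x) = x + σ x := by
  classical
  have : Algebra.IsQuadraticExtension ℚ K := { finrank_eq_two' := hdeg }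
  have hcard : Nat.card Gal(K/ℚ) = 2 := (IsGalois.card_aut_eq_finrank ℚ K).trans hdeg
  obtain ⟨σ, hσ, huniq⟩ := (Nat.card_eq_two_iff' (1 : Gal(K/ℚ))).1 hcard
  refine ⟨σ, fun x => ?_, fun x => ?_⟩
  · have : σ * σ = 1 := by
      by_contra h
      exact hσ (by simpa using huniq _ h)
    simpa using congrArg (fun τ : Gal(K/ℚ) => τ x) this
  · rw [trace_eq_sum_automorphisms]
    have : (Finset.univ : Finset Gal(K/ℚ)) = {1, σ} := by
      ext τ
      by_cases h : τ = 1
      · simp [h]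
      · simp [huniq τ h]
    rw [this, Finset.sum_pair (Ne.symm hσ)]
    simp

lemma exists_sqrt_discr (hdeg : Module.finrank ℚ K = 2) :
    ∃ (σ : 𝓞 K →+* 𝓞 K) (α : 𝓞 K), (∀ x, ∃ t : ℤ, x + σ x = t) ∧
      σ α = -α ∧ α ^ 2 = (discr K : 𝓞 K) := by
  obtain ⟨τ, hτ, htr⟩ := exists_galois_involution hdeg
  let σ : 𝓞 K →+* 𝓞 K := RingOfIntegers.mapRingHom (τ : K →+* K)
  have hσ : ∀ x : 𝓞 K, ((σ x : 𝓞 K) : K) = τ x := fun x => rfl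
  have htrace : ∀ x : 𝓞 K, ((Algebra.trace ℤ (𝓞 K) x : ℤ) : 𝓞 K) = x + σ x := by
    intro x
    apply RingOfIntegers.ext
    have h1 := htr x
    rw [← Algebra.coe_trace_int] at h1
    simpa [hσ] using h1
  have hcard : Fintype.card (Module.Free.ChooseBasisIndex ℤ (𝓞 K)) = 2 := by
    rw [← Module.finrank_eq_card_chooseBasisIndex, RingOfIntegers.rank, hdeg]
  let b := (RingOfIntegers.basis K).reindex (Fintype.equivFinOfCardEq hcard)
  have hσσ : ∀ x, σ (σ x) = x := fun x => RingOfIntegers.ext (hτ x)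
  refine ⟨σ, b 0 * σ (b 1) - b 1 * σ (b 0), fun x => ⟨_, (htrace x).symm⟩, ?_, ?_⟩
  · simp only [map_sub, map_mul, hσσ]
    ring
  · rw [← discr_eq_discr K b, Algebra.discr_def, Matrix.det_fin_two]
    simp only [Algebra.traceMatrix_apply, Algebra.traceForm_apply]
    push_cast
    simp only [htrace, map_mul]
    ring

lemma localSeries_idealCountFn_of_mul_sub_mem (hdeg : Module.finrank ℚ K = 2) {p : ℕ}
    (hp : p.Prime) {γ : 𝓞 K} {c : ℤ} (hc : ¬(p : ℤ) ∣ c)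
    (h : (p : 𝓞 K) ∣ γ * (γ - c)) (h1 : ¬(p : 𝓞 K) ∣ γ) (h2 : ¬(p : 𝓞 K) ∣ γ - c) :
    localSeries p (idealCountFn K)
      * ((1 - PowerSeries.X) * (1 - PowerSeries.C 1 * PowerSeries.X)) = 1 := by
  simp only [← Ideal.mem_span_singleton] at h h1 h2
  rcases isPrime_or_exists_mul_eq_span hdeg hp with hpr | ⟨P, Q, hP, hQ, hPQ⟩
  · exact absurd (hpr.mem_or_mem h) (not_or.2 ⟨h1, h2⟩)
  refine localSeries_idealCountFn_of_ne hp ?_ hP hQ hPQ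
  rintro rfl
  have hpr : P.IsPrime := Ideal.isPrime_of_irreducible_absNorm (by rw [hP]; exact hp)
  obtain ⟨u, v, huv⟩ : IsCoprime (c : 𝓞 K) (p : 𝓞 K) := by
    have := ((Nat.prime_iff_prime_int.1 hp).coprime_iff_not_dvd.2 hc).symm.map
      (Int.castRingHom (𝓞 K))
    simpa using this
  have key : ∀ δ : 𝓞 K, c * δ ∈ Ideal.span {(p : 𝓞 K)} → δ ∈ Ideal.span {(p : 𝓞 K)} := by
    intro δ hδ
    have e : δ = u * (c * δ) + v * δ * p := by
      linear_combination -δ * huv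
    rw [e]
    exact add_mem (Ideal.mul_mem_left _ _ hδ)
      (Ideal.mul_mem_left _ _ (Ideal.mem_span_singleton_self _))
  rcases hpr.mem_or_mem (Ideal.mul_le_right (hPQ ▸ h)) with hγ | hγ
  · refine h1 (key γ ?_)
    rw [show c * γ = γ * γ - γ * (γ - c) by ring]
    exact sub_mem (hPQ ▸ Ideal.mul_mem_mul hγ hγ) h
  · refine h2 (key _ ?_)
    rw [show c * (γ - c) = γ * (γ - c) - (γ - c) * (γ - c) by ring]
    exact sub_mem h (hPQ ▸ Ideal.mul_mem_mul hγ hγ)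

lemma localSeries_idealCountFn_of_dvd_sq (hdeg : Module.finrank ℚ K = 2) {p : ℕ}
    (hp : p.Prime) {γ : 𝓞 K} (h : (p : 𝓞 K) ∣ γ ^ 2) (h1 : ¬(p : 𝓞 K) ∣ γ) :
    localSeries p (idealCountFn K)
      * ((1 - PowerSeries.X) * (1 - PowerSeries.C 0 * PowerSeries.X)) = 1 := by
  simp only [← Ideal.mem_span_singleton] at h h1
  rcases isPrime_or_exists_mul_eq_span hdeg hp with hpr | ⟨P, Q, hP, hQ, hPQ⟩
  · exact absurd (hpr.mem_of_pow_mem _ h) h1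
  by_cases hne : P = Q
  · subst hne
    exact localSeries_idealCountFn_of_sq hp hP hPQ
  have key : ∀ R : Ideal (𝓞 K), Ideal.absNorm R = p → γ ^ 2 ∈ R → R ∣ Ideal.span {γ} := by
    intro R hR hγ
    have hpr : R.IsPrime := Ideal.isPrime_of_irreducible_absNorm (by rw [hR]; exact hp)
    rw [Ideal.dvd_span_singleton]
    exact hpr.mem_of_pow_mem _ hγ
  rw [← hPQ] at h h1
  exact absurd (Ideal.dvd_span_singleton.1 ((isCoprime_of_absNorm_eq_prime hp hne hP hQ).mul_dvd
    (key P hP (Ideal.mul_le_left h)) (key Q hQ (Ideal.mul_le_right h)))) h1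

lemma localSeries_idealCountFn_of_forall_ringHom (hdeg : Module.finrank ℚ K = 2) {p : ℕ}
    (hp : p.Prime) (h : (𝓞 K →+* ZMod p) → False) :
    localSeries p (idealCountFn K)
      * ((1 - PowerSeries.X) * (1 - PowerSeries.C (-1) * PowerSeries.X)) = 1 := by
  rcases isPrime_or_exists_mul_eq_span hdeg hp with hpr | ⟨P, Q, hP, hQ, hPQ⟩
  · exact localSeries_idealCountFn_of_isPrime hdeg hp hpr
  have hcard : Nat.card (𝓞 K ⧸ P) = p := hP
  have : Finite (𝓞 K ⧸ P) := Nat.finite_of_card_ne_zero (by rw [hcard]; exact hp.ne_zero)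
  let := Fintype.ofFinite (𝓞 K ⧸ P)
  rw [Nat.card_eq_fintype_card] at hcard
  exact (h ((ZMod.ringEquivOfPrime _ hp hcard).symm.toRingHom.comp (Ideal.Quotient.mk P))).elim

end QuadraticSplitting

section KroneckerFactor
open NumberField

variable {K : Type*} [Field K] [NumberField K]

lemma exists_two_mul_eq_of_sq_eq {x : 𝓞 K} {s t : ℤ} (h : x ^ 2 = 2 * s * x + 4 * t) :
    ∃ y : 𝓞 K, 2 * y = x ∧ y ^ 2 = s * y + t := by
  have hK : algebraMap (𝓞 K) K x ^ 2 = 2 * s * x + 4 * t := by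
    have := congrArg (algebraMap (𝓞 K) K) h
    simpa only [map_pow, map_add, map_mul, map_intCast, map_ofNat] using this
  have hy : (algebraMap (𝓞 K) K x / 2) ^ 2 = s * (algebraMap (𝓞 K) K x / 2) + t := by
    rw [div_pow, hK]
    ring
  have hint : IsIntegral ℤ (algebraMap (𝓞 K) K x / 2) := by
    refine ⟨Polynomial.X ^ 2 - (Polynomial.C s * Polynomial.X + Polynomial.C t), ?_, ?_⟩
    · exact Polynomial.monic_X_pow_sub
        (Polynomial.degree_linear_le.trans_lt (by exact_mod_cast one_lt_two))
    · simp only [Polynomial.eval₂_sub, Polynomial.eval₂_add, Polynomial.eval₂_mul,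
        Polynomial.eval₂_pow, Polynomial.eval₂_X, Polynomial.eval₂_C]
      rw [hy, algebraMap_int_eq, eq_intCast, eq_intCast, sub_self]
  obtain ⟨y, hxy⟩ : ∃ y : 𝓞 K, algebraMap (𝓞 K) K y = algebraMap (𝓞 K) K x / 2 := ⟨⟨_, hint⟩, rfl⟩
  refine ⟨y, RingOfIntegers.coe_injective ?_, RingOfIntegers.coe_injective ?_⟩
  · rw [map_mul, map_ofNat, hxy]
    ring
  · rw [map_add, map_mul, map_pow, map_intCast, map_intCast, hxy, hy]

lemma dvd_two_mul_of_dvd_add (hdeg : Module.finrank ℚ K = 2) {σ : 𝓞 K →+* 𝓞 K}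
    (hσ : ∀ x, ∃ t : ℤ, x + σ x = t) {α : 𝓞 K} (hα : σ α = -α) {k x : ℤ}
    (h : (k : 𝓞 K) ∣ α + x) : k ∣ 2 * x := by
  obtain ⟨β, hβ⟩ := h
  obtain ⟨t, ht⟩ := hσ β
  refine intCast_dvd_intCast_ringOfIntegers hdeg ⟨t, ?_⟩
  have h2 := congrArg σ hβ
  simp only [map_add, map_mul, map_intCast, hα] at h2
  rw [← ht]
  push_cast
  linear_combination hβ + h2

lemma localSeries_idealCountFn_odd (hdeg : Module.finrank ℚ K = 2)
    (hd : IsFundamentalDiscriminant (discr K)) {p : ℕ} (hp : p.Prime) (hp2 : p ≠ 2) :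
    localSeries p (idealCountFn K) * ((1 - PowerSeries.X) *
      (1 - PowerSeries.C (kroneckerChi (discr K) p : ℝ) * PowerSeries.X)) = 1 := by
  obtain ⟨σ, α, hσ, hα, hsq⟩ := exists_sqrt_discr hdeg
  have hpZ := Nat.prime_iff_prime_int.1 hp
  have hp2' : ¬(p : ℤ) ∣ 2 := fun h => hp2 ((Nat.prime_dvd_prime_iff_eq hp Nat.prime_two).1
    (by exact_mod_cast h))
  have : Fact p.Prime := ⟨hp⟩
  rw [kroneckerChi, if_neg hp2]
  split_ifs with hpd hs
  · have hp1 : ¬(p : 𝓞 K) ∣ α := by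
      rintro ⟨β, rfl⟩
      refine hd.not_sq_dvd hp hp2 (intCast_dvd_intCast_ringOfIntegers hdeg ⟨β ^ 2, ?_⟩)
      rw [← hsq]
      push_cast
      ring
    rw [Int.cast_zero]
    refine localSeries_idealCountFn_of_dvd_sq hdeg hp ?_ hp1
    rw [hsq]
    obtain ⟨c, hc⟩ := hpd
    exact ⟨c, by rw [hc]; push_cast; rfl⟩
  · obtain ⟨y, hy⟩ := hs
    obtain ⟨x, rfl⟩ := ZMod.intCast_surjective y
    have hdx : (p : ℤ) ∣ discr K - x * x := by
      rw [← Int.cast_mul, ZMod.intCast_eq_intCast_iff_dvd_sub] at hy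
      rw [← dvd_neg, neg_sub]
      exact hy
    have hx : ¬(p : ℤ) ∣ 2 * x := by
      intro h
      have h1 := (hpZ.dvd_or_dvd h).resolve_left hp2'
      exact hpd ((dvd_sub_left (h1.mul_right x)).1 hdx)
    rw [Int.cast_one]
    refine localSeries_idealCountFn_of_mul_sub_mem hdeg hp (γ := α + x) (c := 2 * x) hx ?_ ?_ ?_
    · obtain ⟨c, hc⟩ := hdx
      refine ⟨c, ?_⟩
      have hc' : ((discr K - x * x : ℤ) : 𝓞 K) = ((p * c : ℤ) : 𝓞 K) := by rw [hc]
      push_cast at hc' ⊢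
      linear_combination hsq + hc'
    · intro h
      exact hx (dvd_two_mul_of_dvd_add hdeg hσ hα (by exact_mod_cast h))
    · intro h
      have h2 : ((p : ℤ) : 𝓞 K) ∣ α + ((-x : ℤ) : 𝓞 K) := by
        convert h using 1
        · simp
        · push_cast
          ring
      have h3 := dvd_two_mul_of_dvd_add hdeg hσ hα h2
      rw [mul_neg, dvd_neg] at h3
      exact hx h3
  · push_cast
    refine localSeries_idealCountFn_of_forall_ringHom hdeg hp fun φ => hs ⟨φ α, ?_⟩
    rw [← sq, ← map_pow, hsq, map_intCast]

lemma localSeries_idealCountFn_two (hdeg : Module.finrank ℚ K = 2)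
    (hd : IsFundamentalDiscriminant (discr K)) :
    localSeries 2 (idealCountFn K) * ((1 - PowerSeries.X) *
      (1 - PowerSeries.C (kroneckerChi (discr K) 2 : ℝ) * PowerSeries.X)) = 1 := by
  obtain ⟨σ, α, hσ, hα, hsq⟩ := exists_sqrt_discr hdeg
  rw [kroneckerChi, if_pos rfl]
  rcases hd with ⟨h1, -⟩ | ⟨m, hm, hm4, -⟩
  · obtain ⟨t, ht⟩ : (4 : ℤ) ∣ discr K - 1 := by omega
    obtain ⟨ω, hω, hω2⟩ := exists_two_mul_eq_of_sq_eq (x := α + 1) (s := 1) (t := t) (by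
      have ht' : ((discr K - 1 : ℤ) : 𝓞 K) = ((4 * t : ℤ) : 𝓞 K) := by rw [ht]
      push_cast at ht' ⊢
      linear_combination hsq + ht')
    split_ifs with h8 h8'
    · rw [Int.cast_one]
      refine localSeries_idealCountFn_of_mul_sub_mem hdeg Nat.prime_two (γ := ω) (c := 1)
        (by norm_num) ?_ ?_ ?_
      · obtain ⟨u, hu⟩ : (2 : ℤ) ∣ t := by omega
        refine ⟨u, ?_⟩
        rw [hu] at hω2
        push_cast at hω2 ⊢
        linear_combination hω2
      · rintro ⟨β, hβ⟩
        have h3 : ((4 : ℤ) : 𝓞 K) ∣ α + (1 : ℤ) := ⟨β, by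
          push_cast at hβ ⊢
          linear_combination -hω + 2 * hβ⟩
        have := dvd_two_mul_of_dvd_add hdeg hσ hα h3
        norm_num at this
      · rintro ⟨β, hβ⟩
        have h3 : ((4 : ℤ) : 𝓞 K) ∣ α + (-1 : ℤ) := ⟨β, by
          push_cast at hβ ⊢
          linear_combination -hω + 2 * hβ⟩
        have := dvd_two_mul_of_dvd_add hdeg hσ hα h3
        norm_num at this
    · push_cast
      refine localSeries_idealCountFn_of_forall_ringHom hdeg Nat.prime_two fun φ => ?_
      have h2 := congrArg φ hω2
      simp only [map_pow, map_add, map_intCast, Int.cast_one, one_mul] at h2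
      have ht2 : (t : ZMod 2) = 1 := by
        have : t % 2 = 1 % 2 := by omega
        exact_mod_cast (ZMod.intCast_eq_intCast_iff' t 1 2).2 this
      rw [ht2] at h2
      revert h2
      generalize φ ω = w
      revert w
      decide
    · omega
  · obtain ⟨β, hβ, hβ2⟩ := exists_two_mul_eq_of_sq_eq (x := α) (s := 0) (t := m) (by
      rw [hsq, hm]
      push_cast
      ring)
    rw [if_neg (by omega), if_neg (by omega), Int.cast_zero]
    rcases hm4 with hm4 | hm4
    · obtain ⟨u, hu⟩ : (2 : ℤ) ∣ m := by omega
      refine localSeries_idealCountFn_of_dvd_sq hdeg Nat.prime_two (γ := β) ⟨u, ?_⟩ ?_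
      · rw [hβ2, hu]
        push_cast
        ring
      · rintro ⟨δ, rfl⟩
        have : ((4 : ℤ) : 𝓞 K) ∣ m := ⟨δ ^ 2, by
          push_cast at hβ2 ⊢
          linear_combination -hβ2⟩
        have := intCast_dvd_intCast_ringOfIntegers hdeg this
        omega
    · obtain ⟨u, hu⟩ : (2 : ℤ) ∣ m + 1 := by omega
      refine localSeries_idealCountFn_of_dvd_sq hdeg Nat.prime_two (γ := β + 1) ⟨u + β, ?_⟩ ?_
      · have hu' : ((m + 1 : ℤ) : 𝓞 K) = ((2 * u : ℤ) : 𝓞 K) := by rw [hu]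
        push_cast at hβ2 hu' ⊢
        linear_combination hβ2 + hu'
      · rintro ⟨δ, hδ⟩
        have : ((4 : ℤ) : 𝓞 K) ∣ ((m - 1 : ℤ) : 𝓞 K) := ⟨δ ^ 2 - δ, by
          push_cast at hβ2 hδ ⊢
          linear_combination -hβ2 + (β - 1 + 2 * δ) * hδ⟩
        have := intCast_dvd_intCast_ringOfIntegers hdeg this
        omega

/-- The Euler factor at `p` of the Dedekind zeta function of a quadratic field. -/
lemma localSeries_idealCountFn (hdeg : Module.finrank ℚ K = 2)
    (hd : IsFundamentalDiscriminant (discr K)) {p : ℕ} (hp : p.Prime) :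
    localSeries p (idealCountFn K) * ((1 - PowerSeries.X) *
      (1 - PowerSeries.C (kroneckerChi (discr K) p : ℝ) * PowerSeries.X)) = 1 := by
  by_cases hp2 : p = 2
  · subst hp2
    exact localSeries_idealCountFn_two hdeg hd
  · exact localSeries_idealCountFn_odd hdeg hd hp hp2

end KroneckerFactor

section Asymptotic
open NumberField

lemma localSeries_squareMoebius {p : ℕ} (hp : p.Prime) :
    localSeries p squareMoebius = 1 - PowerSeries.X ^ 2 := by
  ext k
  rw [localSeries, PowerSeries.coeff_mk, squareMoebius_prime_pow hp]
  rcases k with _ | _ | _ | k <;> simp [PowerSeries.coeff_X_pow, PowerSeries.coeff_one]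

lemma isMultiplicative_conductorFn (χ : ℕ → ℝ) (f : ℕ) : (conductorFn χ f).IsMultiplicative :=
  isMultiplicative_ofPrimePow _

/-- The Dirichlet series of the counting function of square roots of `n` modulo `a` is
`ζ_K(s) / ζ(2s)` up to finitely many Euler factors. -/
lemma sqrtCountFn_eq_mul {K : Type*} [Field K] [NumberField K]
    (hdeg : Module.finrank ℚ K = 2) (hfund : IsFundamentalDiscriminant (discr K))
    {n : ℤ} {f : ℕ} (hf : 0 < f) (hfactor : 4 * n = (f : ℤ) ^ 2 * discr K) :
    sqrtCountFn n = conductorFn (fun p => (kroneckerChi (discr K) p : ℝ)) f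
      * (squareMoebius * idealCountFn K) := by
  refine (ArithmeticFunction.IsMultiplicative.eq_iff_eq_on_prime_powers _
    (isMultiplicative_sqrtCountFn n) _ ((isMultiplicative_conductorFn _ f).mul
      (isMultiplicative_squareMoebius.mul isMultiplicative_idealCountFn))).2 fun p k hp => ?_
  have h1 := hasConductor_factorization hf hfactor hfund hp
  have h2 := localSeries_idealCountFn hdeg hfund hp
  have key : localSeries p (sqrtCountFn n)
      = localSeries p (conductorFn (fun p => (kroneckerChi (discr K) p : ℝ)) f
        * (squareMoebius * idealCountFn K)) := by
    rw [localSeries_mul hp, localSeries_mul hp, localSeries_conductorFn _ _ hp,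
      localSeries_squareMoebius hp]
    rw [HasConductor] at h1
    linear_combination localSeries p (idealCountFn K) * h1 - localSeries p (sqrtCountFn n) * h2
  simpa only [localSeries, PowerSeries.coeff_mk] using congrArg (PowerSeries.coeff k) key

lemma isLittleO_sub_two_mul_of_tendsto_mean {D : ℝ → ℝ} {S : ℕ → ℝ} {C L : ℝ}
    (hD : ∀ T, 0 ≤ T → |D T - 2 * S ⌊T⌋₊| ≤ C)
    (hS : Tendsto (fun N : ℕ => S N / N) atTop (nhds L)) :
    (fun T => D T - 2 * L * T) =o[atTop] fun T : ℝ => T := by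
  rw [isLittleO_iff_tendsto' (by
    filter_upwards [eventually_gt_atTop 0] with T hT h using absurd h hT.ne')]
  have h1 : Tendsto (fun T : ℝ => (D T - 2 * S ⌊T⌋₊) / T) atTop (nhds 0) := by
    refine squeeze_zero_norm' (a := fun T => C / T) ?_ (tendsto_const_nhds.div_atTop tendsto_id)
    filter_upwards [eventually_gt_atTop 0] with T hT
    rw [Real.norm_eq_abs, abs_div, abs_of_pos hT]
    gcongr
    exact hD T hT.le
  have h2 : Tendsto (fun T : ℝ => S ⌊T⌋₊ / (⌊T⌋₊ : ℝ) * ((⌊T⌋₊ : ℝ) / T)) atTop (nhds (L * 1)) :=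
    (hS.comp tendsto_nat_floor_atTop).mul tendsto_nat_floor_div_atTop
  have h3 := (h1.add (h2.const_mul 2)).sub_const (2 * L)
  refine (h3.congr' ?_).trans (by simp)
  filter_upwards [eventually_ge_atTop 1] with T hT
  have hfl : (⌊T⌋₊ : ℝ) ≠ 0 := by
    exact_mod_cast (Nat.floor_pos.2 hT).ne'
  have hT0 : T ≠ 0 := by positivity
  field_simp
  ring

end Asymptotic

/-- **Theorem 3 (b).** Let `n > 0` be a nonsquare integer and write `4n = f² d₀` with
`d₀ > 0` a fundamental discriminant (`d₀` is the discriminant of the real quadratic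
field `K = ℚ(√d₀)`, whose class number is `h(d₀) = classNumber K` and whose regulator is
`R = log ε_{d₀} = regulator K`). Then, as `T → ∞`,
`D_T^n = (12 T R h(d₀) / (π² n^{1/2})) ∏_{p^e ∥ f} (σ₁(p^e) - χ_{d₀}(p) σ₁(p^{e-1})) + o(T)`. -/
theorem total_count_positive_nonsquare (n : ℤ) (hn : 0 < n) (hns : ¬∃ m : ℤ, n = m ^ 2)
    (d₀ : ℤ) (f : ℕ) (hf : 0 < f)
    (hfactor : 4 * n = (f : ℤ) ^ 2 * d₀)
    (hfund : IsFundamentalDiscriminant d₀) (hd₀ : 0 < d₀)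
    (K : Type) [Field K] [NumberField K]
    (hdeg : Module.finrank ℚ K = 2) (hdiscr : NumberField.discr K = d₀) :
    (fun T : ℝ => (DTn n T : ℝ) -
        12 * T * NumberField.Units.regulator K * (NumberField.classNumber K : ℝ) /
            (Real.pi ^ 2 * Real.sqrt (n : ℝ)) *
          ∏ p ∈ f.primeFactors,
            ((sigmaOne (p ^ (f.factorization p)) : ℝ) -
              (kroneckerChi d₀ p : ℝ) * (sigmaOne (p ^ (f.factorization p - 1)) : ℝ)))
      =o[atTop] (fun T : ℝ => T) := by
  subst hdiscr
  obtain ⟨hsumm, hsum⟩ := summable_and_hasSum_conductorFn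
    (fun p => (kroneckerChi (NumberField.discr K) p : ℝ)) hf.ne'
  have hmean := tendsto_mean_dirichlet_mul _ _ (tendsto_mean_dirichlet_mul _ _
    (tendsto_mean_idealCountFn (K := K)) summable_norm_squareMoebius_div) hsumm
  rw [← sqrtCountFn_eq_mul hdeg hfund hf hfactor, hasSum_squareMoebius_div.tsum_eq, hsum.tsum_eq,
    dedekindZeta_residue_of_real_quadratic hdeg hd₀] at hmean
  obtain ⟨C, hC⟩ := DTn_sub_two_mul_sum_bounded hn hns
  refine (isLittleO_sub_two_mul_of_tendsto_mean hC hmean).congr_left fun T => ?_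
  have hf' : (0 : ℝ) < f := by exact_mod_cast hf
  have hn' : (0 : ℝ) < n := by exact_mod_cast hn
  have hsqrt : 2 * √(n : ℝ) = f * √(NumberField.discr K : ℝ) := by
    have h4 : (4 * n : ℝ) = (f : ℝ) ^ 2 * NumberField.discr K := by exact_mod_cast hfactor
    have h5 := congrArg Real.sqrt h4
    rwa [Real.sqrt_mul (by norm_num), Real.sqrt_mul (by positivity), Real.sqrt_sq hf'.le,
      show (4 : ℝ) = 2 ^ 2 by norm_num, Real.sqrt_sq (by norm_num)] at h5
  have hsd : √(NumberField.discr K : ℝ) = 2 * √(n : ℝ) / f := by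
    field_simp
    linarith
  have hsn : 0 < √(n : ℝ) := Real.sqrt_pos.2 hn'
  rw [hsd]
  field_simp
  ring
end

section
/- Let n be a positive perfect square. Then, as T → ∞, D_T^n = 12·T·log T/π² + o(T·log T). -/
open Filter Real Asymptotics

lemma abs_card_filter_dvd_sub_le {e f : ℕ} (he : 0 < e) (hc : f.Coprime e) (k K : ℕ) :
    |(((Finset.Icc 1 K).filter (fun d => e ∣ d * f + k)).card : ℝ) - K / e| ≤ 1 := by
  obtain ⟨v, hv⟩ : ∃ v : ℕ, ∀ d, e ∣ d * f + k ↔ d ≡ v [MOD e] := by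
    have : NeZero e := ⟨he.ne'⟩
    let u := ZMod.unitOfCoprime f hc
    refine ⟨(-(k : ZMod e) * (u⁻¹ : (ZMod e)ˣ)).val, fun d => ?_⟩
    rw [← ZMod.natCast_eq_natCast_iff, ZMod.natCast_zmod_val, ← ZMod.natCast_eq_zero_iff,
      Units.eq_mul_inv_iff_mul_eq, eq_neg_iff_add_eq_zero, ZMod.coe_unitOfCoprime]
    push_cast
    rfl
  have hcard := Nat.Ioc_filter_modEq_card 0 K he v
  have hI : Finset.Icc 1 K = Finset.Ioc 0 K := rfl
  simp_rw [hv, hI]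
  have hq : |((((Finset.Ioc 0 K).filter (fun d => d ≡ v [MOD e])).card : ℤ) : ℚ) - K / e| ≤ 1 := by
    rw [hcard]
    have hKe : (0 : ℚ) ≤ K / e := by positivity
    have h1 : ((K : ℚ) - v) / e = ((0 : ℕ) - v : ℚ) / e + K / e := by push_cast; ring
    rw [h1]
    generalize ((0 : ℕ) - v : ℚ) / e = x at *
    generalize (K : ℚ) / e = y at *
    have hmono : ⌊x⌋ ≤ ⌊x + y⌋ := Int.floor_mono (by linarith)
    rw [max_eq_left (by linarith)]
    push_cast
    have a1 := Int.floor_le x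
    have a2 := Int.lt_floor_add_one x
    have a3 := Int.floor_le (x + y)
    have a4 := Int.lt_floor_add_one (x + y)
    rw [abs_le]
    constructor <;> linarith
  have := (Rat.cast_le (K := ℝ)).2 hq
  push_cast at this
  exact this

lemma hasSum_moebius_div_sq :
    HasSum (fun d : ℕ => (ArithmeticFunction.moebius d : ℝ) / (d : ℝ) ^ 2) (6 / π ^ 2) := by
  have hs : LSeriesSummable (fun n => (ArithmeticFunction.moebius n : ℂ)) 2 :=
    ArithmeticFunction.LSeriesSummable_moebius_iff.2 (by norm_num)
  have h1 := ArithmeticFunction.LSeries_zeta_mul_Lseries_moebius (s := 2) (by norm_num)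
  rw [ArithmeticFunction.LSeries_zeta_eq_riemannZeta (by norm_num), riemannZeta_two] at h1
  have h2 := hs.LSeriesHasSum
  have hpi : (π : ℂ) ≠ 0 := by exact_mod_cast Real.pi_ne_zero
  have h3 : LSeries (fun n => (ArithmeticFunction.moebius n : ℂ)) 2 = ((6 / π ^ 2 : ℝ) : ℂ) := by
    push_cast
    rw [eq_div_iff (by simp), mul_comm]
    linear_combination 6 * h1
  rw [h3] at h2
  rw [← Complex.hasSum_ofReal]
  refine HasSum.congr_fun h2 fun d => ?_
  rcases Nat.eq_zero_or_pos d with rfl | hd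
  · simp
  · rw [LSeries.term_of_ne_zero hd.ne']
    push_cast
    norm_cast

lemma totient_div_sq_eq (n : ℕ) (hn : 0 < n) : (n.totient : ℝ) / (n : ℝ) ^ 2 =
    ∑ x ∈ n.divisorsAntidiagonal,
      (ArithmeticFunction.moebius x.1 : ℝ) / (x.1 : ℝ) ^ 2 * (x.2 : ℝ)⁻¹ := by
  have h := (ArithmeticFunction.sum_eq_iff_sum_mul_moebius_eq (R := ℝ)
    (f := fun n => (n.totient : ℝ)) (g := fun n => (n : ℝ))).1
    (fun n _ => by exact_mod_cast Nat.sum_totient n) n hn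
  rw [← h, Finset.sum_div]
  refine Finset.sum_congr rfl fun x hx => ?_
  obtain ⟨hx1, hx2⟩ := Nat.mem_divisorsAntidiagonal.1 hx
  have : x.1 ≠ 0 := by rintro h; simp [h] at hx1; omega
  have : x.2 ≠ 0 := by rintro h; simp [h] at hx1; omega
  rw [← hx1]
  push_cast
  field_simp

lemma sum_totient_div_sq_eq (M : ℕ) : ∑ e ∈ Finset.Icc 1 M, (e.totient : ℝ) / (e : ℝ) ^ 2 =
    ∑ d ∈ Finset.Icc 1 M,
      (ArithmeticFunction.moebius d : ℝ) / (d : ℝ) ^ 2 * (harmonic (M / d) : ℝ) := by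
  let F : ArithmeticFunction ℝ :=
    ⟨fun d => (ArithmeticFunction.moebius d : ℝ) / (d : ℝ) ^ 2, by simp⟩
  let G : ArithmeticFunction ℝ := ⟨fun d => (d : ℝ)⁻¹, by simp⟩
  have h := ArithmeticFunction.sum_Ioc_mul_eq_sum_sum F G M
  have hI : ∀ K, Finset.Icc 1 K = Finset.Ioc 0 K := fun _ => rfl
  rw [hI]
  convert h using 1
  · refine Finset.sum_congr rfl fun e he => ?_
    rw [totient_div_sq_eq e (Finset.mem_Ioc.1 he).1]
    rfl
  · refine Finset.sum_congr rfl fun d _ => ?_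
    rw [harmonic_eq_sum_Icc]
    push_cast
    rfl

lemma tendsto_harmonic_div_log (d : ℕ) (hd : 0 < d) :
    Tendsto (fun M : ℕ => (harmonic (M / d) : ℝ) / Real.log M) atTop (nhds 1) := by
  have hlog : Tendsto (fun M : ℕ => Real.log M) atTop atTop :=
    Real.tendsto_log_atTop.comp tendsto_natCast_atTop_atTop
  have hz : ∀ c : ℝ, Tendsto (fun M : ℕ => 1 + c / Real.log M) atTop (nhds 1) := fun c => by
    simpa using (hlog.const_div_atTop c).const_add 1
  refine tendsto_of_tendsto_of_tendsto_of_le_of_le' (hz (-Real.log d)) (hz 1) ?_ ?_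
  · filter_upwards [eventually_ge_atTop 2] with M hM
    have hM' : (1 : ℝ) < M := by exact_mod_cast hM
    have hl := Real.log_pos hM'
    have hd' : (0 : ℝ) < d := by exact_mod_cast hd
    have := log_le_harmonic_floor ((M : ℝ) / d) (by positivity)
    rw [Nat.floor_div_eq_div, Real.log_div (by positivity) (by positivity)] at this
    rw [le_div_iff₀ hl]
    field_simp
    linarith
  · filter_upwards [eventually_ge_atTop (max 2 d)] with M hM
    have hM' : (1 : ℝ) < M := by exact_mod_cast (le_trans (le_max_left _ _) hM)
    have hl := Real.log_pos hM'
    have h1 : 1 ≤ M / d := (Nat.one_le_div_iff hd).2 (le_trans (le_max_right _ _) hM)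
    have := harmonic_le_one_add_log (M / d)
    have h2 : Real.log ((M / d : ℕ) : ℝ) ≤ Real.log M :=
      Real.log_le_log (by exact_mod_cast h1) (by exact_mod_cast Nat.div_le_self _ _)
    rw [div_le_iff₀ hl]
    field_simp
    linarith

lemma tendsto_sum_totient_div_sq :
    Tendsto (fun M : ℕ => (∑ e ∈ Finset.Icc 1 M, (e.totient : ℝ) / (e : ℝ) ^ 2) / Real.log M)
      atTop (nhds (6 / π ^ 2)) := by
  have key : Tendsto (fun M : ℕ => ∑' d : ℕ, (ArithmeticFunction.moebius d : ℝ) / (d : ℝ) ^ 2 *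
      ((harmonic (M / d) : ℝ) / Real.log M)) atTop
      (nhds (∑' d : ℕ, (ArithmeticFunction.moebius d : ℝ) / (d : ℝ) ^ 2)) := by
    refine tendsto_tsum_of_dominated_convergence
      (bound := fun d : ℕ => 2 * (1 / (d : ℝ) ^ 2)) ?_ ?_ ?_
    · exact (Real.summable_one_div_nat_pow.2 (by norm_num)).mul_left 2
    · intro d
      rcases Nat.eq_zero_or_pos d with rfl | hd
      · simp
      · simpa using (tendsto_harmonic_div_log d hd).const_mul
          ((ArithmeticFunction.moebius d : ℝ) / (d : ℝ) ^ 2)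
    · filter_upwards [eventually_ge_atTop 3] with M hM d
      have hM' : (3 : ℝ) ≤ M := by exact_mod_cast hM
      have hl : 1 ≤ Real.log M := by
        rw [Real.le_log_iff_exp_le (by linarith)]
        linarith [Real.exp_one_lt_d9]
      have hmu : |(ArithmeticFunction.moebius d : ℝ)| ≤ 1 := by
        exact_mod_cast ArithmeticFunction.abs_moebius_le_one (n := d)
      have h0 : (0 : ℝ) ≤ harmonic (M / d) := by
        rw [harmonic_eq_sum_Icc]; push_cast; positivity
      have h1 : (harmonic (M / d) : ℝ) ≤ 2 * Real.log M := by
        have := harmonic_le_one_add_log (M / d)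
        have h2 : Real.log ((M / d : ℕ) : ℝ) ≤ Real.log M := by
          rcases Nat.eq_zero_or_pos (M / d) with h | h
          · rw [h]; simp; linarith
          · exact Real.log_le_log (by exact_mod_cast h) (by exact_mod_cast Nat.div_le_self _ _)
        linarith
      rw [norm_mul, Real.norm_eq_abs, Real.norm_eq_abs, abs_div, abs_div, abs_of_nonneg h0,
        abs_of_pos (by linarith : 0 < Real.log M), abs_of_nonneg (by positivity : (0 : ℝ) ≤ d ^ 2),
        mul_comm (2 : ℝ)]
      gcongr
      rw [div_le_iff₀ (by linarith)]
      exact h1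
  rw [hasSum_moebius_div_sq.tsum_eq] at key
  refine key.congr fun M => ?_
  rw [sum_totient_div_sq_eq, Finset.sum_div]
  rw [tsum_eq_sum (s := Finset.Icc 1 M)]
  · exact Finset.sum_congr rfl fun d _ => by ring
  · intro d hd
    rcases Nat.eq_zero_or_pos d with rfl | hd0
    · simp
    · have : M / d = 0 := Nat.div_eq_of_lt (by simp at hd; omega)
      simp [this]

lemma gcd_eq_gcd_of_modEq {n a b : ℤ} (h : a ≡ b [ZMOD n]) : Int.gcd n a = Int.gcd n b := by
  rw [Int.gcd_comm n a, Int.gcd_comm n b, ← Int.gcd_emod a, h.eq, Int.gcd_emod]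

/-- Pairs `(a, b)` with `1 ≤ a ≤ N`, `0 ≤ b < a` and `b ^ 2 ≡ m ^ 2` modulo `a`. -/
noncomputable def sqRoots (m N : ℕ) : Finset (ℕ × ℤ) :=
  (Finset.Icc 1 N ×ˢ Finset.Ico 0 (N : ℤ)).filter
    (fun p => p.2 < p.1 ∧ (p.1 : ℤ) ∣ p.2 ^ 2 - (m : ℤ) ^ 2)

lemma mem_sqRoots {m N : ℕ} {p : ℕ × ℤ} : p ∈ sqRoots m N ↔
    1 ≤ p.1 ∧ p.1 ≤ N ∧ 0 ≤ p.2 ∧ p.2 < p.1 ∧ (p.1 : ℤ) ∣ p.2 ^ 2 - (m : ℤ) ^ 2 := by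
  simp only [sqRoots, Finset.mem_filter, Finset.mem_product, Finset.mem_Icc, Finset.mem_Ico]
  constructor
  · rintro ⟨⟨⟨h1, h2⟩, h3, h4⟩, h5, h6⟩
    exact ⟨h1, h2, h3, h5, h6⟩
  · rintro ⟨h1, h2, h3, h5, h6⟩
    exact ⟨⟨⟨h1, h2⟩, h3, by omega⟩, h5, h6⟩

/-- Triples `(e, f, d)` with `1 ≤ e ≤ M`, `f` a reduced residue modulo `e`, `1 ≤ d ≤ K e` and
`d * f ≡ -k` modulo `e`. -/
def triples (k M : ℕ) (K : ℕ → ℕ) : Finset (Σ _ : ℕ, Σ _ : ℕ, ℕ) :=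
  (Finset.Icc 1 M).sigma fun e => ((Finset.range e).filter e.Coprime).sigma fun f =>
    (Finset.Icc 1 (K e)).filter (fun d => e ∣ d * f + k)

lemma mem_triples {k M : ℕ} {K : ℕ → ℕ} {e f d : ℕ} :
    (⟨e, f, d⟩ : Σ _ : ℕ, Σ _ : ℕ, ℕ) ∈ triples k M K ↔
      (1 ≤ e ∧ e ≤ M) ∧ (f < e ∧ e.Coprime f) ∧ (1 ≤ d ∧ d ≤ K e) ∧ e ∣ d * f + k := by
  simp [triples]

lemma abs_card_triples_sub_le (k M : ℕ) (K : ℕ → ℕ) :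
    |((triples k M K).card : ℝ) - ∑ e ∈ Finset.Icc 1 M, (e.totient : ℝ) * (K e / e)| ≤
      (M : ℝ) ^ 2 := by
  rw [triples, Finset.card_sigma, Nat.cast_sum, ← Finset.sum_sub_distrib]
  refine (Finset.abs_sum_le_sum_abs _ _).trans ?_
  have : ∀ e ∈ Finset.Icc 1 M, |((((Finset.range e).filter e.Coprime).sigma fun f =>
      (Finset.Icc 1 (K e)).filter (fun d => e ∣ d * f + k)).card : ℝ) -
      (e.totient : ℝ) * (K e / e)| ≤ M := by
    intro e he
    obtain ⟨he1, he2⟩ := Finset.mem_Icc.1 he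
    rw [Finset.card_sigma, Nat.cast_sum]
    have h1 : (e.totient : ℝ) * (K e / e) =
        ∑ f ∈ (Finset.range e).filter e.Coprime, (K e / e : ℝ) := by
      rw [Finset.sum_const, nsmul_eq_mul]; rfl
    rw [h1, ← Finset.sum_sub_distrib]
    refine (Finset.abs_sum_le_sum_abs _ _).trans ?_
    refine (Finset.sum_le_sum (g := fun _ => (1 : ℝ)) fun f hf => ?_).trans ?_
    · exact abs_card_filter_dvd_sub_le he1 (Finset.mem_filter.1 hf).2.symm k (K e)
    · rw [Finset.sum_const, nsmul_eq_mul, mul_one]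
      have : ((Finset.range e).filter e.Coprime).card ≤ e := Nat.totient_le e
      exact_mod_cast this.trans he2
  refine (Finset.sum_le_sum this).trans ?_
  rw [Finset.sum_const, nsmul_eq_mul, Nat.card_Icc]
  simp [sq]

/-- The complementary divisor of `gcd (a, b - m)` in `a`. -/
def cofactor (m : ℤ) (p : ℕ × ℤ) : ℕ := p.1 / Int.gcd p.1 (p.2 - m)

/-- The triple `(e, f, d)` with `d = gcd (a, b - m)`, `a = d * e` and `b - m ≡ d * f`. -/
def toTriple (m : ℤ) (p : ℕ × ℤ) : Σ _ : ℕ, Σ _ : ℕ, ℕ :=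
  ⟨cofactor m p, ((p.2 - m) / (Int.gcd p.1 (p.2 - m) : ℤ) % (cofactor m p : ℤ)).toNat,
    Int.gcd p.1 (p.2 - m)⟩

lemma exists_factorization (m : ℤ) {p : ℕ × ℤ} (hp : 1 ≤ p.1) :
    ∃ x : ℤ, 1 ≤ Int.gcd p.1 (p.2 - m) ∧ 1 ≤ cofactor m p ∧
      p.1 = cofactor m p * Int.gcd p.1 (p.2 - m) ∧
      p.2 - m = Int.gcd p.1 (p.2 - m) * x ∧ Int.gcd (cofactor m p) x = 1 ∧
      (p.2 - m) / (Int.gcd p.1 (p.2 - m) : ℤ) = x := by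
  have hg : 0 < Int.gcd p.1 (p.2 - m) := Int.gcd_pos_of_ne_zero_left _ (by omega)
  have hd1 : Int.gcd p.1 (p.2 - m) ∣ p.1 := by
    have := Int.gcd_dvd_left (p.1 : ℤ) (p.2 - m)
    exact_mod_cast this
  have ha : p.1 = cofactor m p * Int.gcd p.1 (p.2 - m) := (Nat.div_mul_cancel hd1).symm
  refine ⟨(p.2 - m) / (Int.gcd p.1 (p.2 - m) : ℤ), hg, ?_, ha, ?_, ?_, rfl⟩
  · rcases Nat.eq_zero_or_pos (cofactor m p) with h | h
    · rw [h] at ha; omega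
    · exact h
  · exact (Int.mul_ediv_cancel' (Int.gcd_dvd_right _ _)).symm
  · have := Int.gcd_ediv_gcd_ediv_gcd hg
    rw [← this, cofactor]
    push_cast
    rfl

lemma toTriple_mem {m N M : ℕ} {K : ℕ → ℕ} {p : ℕ × ℤ} (hp : p ∈ sqRoots m N)
    (hM : cofactor m p ≤ M) (hK : Int.gcd p.1 (p.2 - m) ≤ K (cofactor m p)) :
    toTriple m p ∈ triples (2 * m) M K := by
  obtain ⟨h1, h2, h3, h4, h5⟩ := mem_sqRoots.1 hp
  obtain ⟨x, hg, he, ha, hb, hc, hx⟩ := exists_factorization m h1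
  rw [toTriple, hx, mem_triples]
  generalize Int.gcd p.1 (p.2 - m) = g at *
  generalize cofactor m p = e at *
  have he' : (0 : ℤ) < e := by omega
  have hf0 := Int.emod_nonneg x he'.ne'
  have hf1 := Int.emod_lt_of_pos x he'
  have hfx : (((x % e).toNat : ℕ) : ℤ) = x % e := Int.toNat_of_nonneg hf0
  refine ⟨⟨he, hM⟩, ⟨by omega, ?_⟩, ⟨hg, hK⟩, ?_⟩
  · rw [← Nat.isCoprime_iff_coprime, hfx, Int.isCoprime_iff_gcd_eq_one,
      gcd_eq_gcd_of_modEq (Int.mod_modEq x e)]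
    exact hc
  · zify
    rw [hfx]
    have h6 : (e : ℤ) ∣ g * x + 2 * m := by
      have h7 : (e : ℤ) * g ∣ (g * x) * (g * x + 2 * m) := by
        have : p.2 ^ 2 - (m : ℤ) ^ 2 = (g * x) * (g * x + 2 * m) := by rw [← hb]; ring
        rw [← this]
        have : ((p.1 : ℕ) : ℤ) = e * g := by exact_mod_cast ha
        rwa [← this]
      have h8 : (e : ℤ) ∣ x * (g * x + 2 * m) := by
        refine (mul_dvd_mul_iff_left (by omega : (g : ℤ) ≠ 0)).1 ?_
        rw [← mul_assoc, mul_comm (g : ℤ) e]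
        exact h7
      exact (Int.isCoprime_iff_gcd_eq_one.2 hc).dvd_of_dvd_mul_left h8
    have h9 : (g : ℤ) * (x % e) + 2 * m ≡ g * x + 2 * m [ZMOD e] :=
      (Int.ModEq.mul_left _ (Int.mod_modEq x e)).add_right _
    exact h9.dvd_iff.2 h6

lemma toTriple_injOn (m N : ℕ) : Set.InjOn (toTriple m) (sqRoots m N) := by
  intro p hp q hq h
  obtain ⟨h1, h2, h3, h4, h5⟩ := mem_sqRoots.1 hp
  obtain ⟨x, hg, he, ha, hb, hc, hx⟩ := exists_factorization m h1
  obtain ⟨h1', h2', h3', h4', h5'⟩ := mem_sqRoots.1 hq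
  obtain ⟨x', hg', he', ha', hb', hc', hx'⟩ := exists_factorization m h1'
  rw [toTriple, toTriple, hx, hx'] at h
  obtain ⟨he2, h⟩ := Sigma.mk.inj_iff.1 h
  obtain ⟨hf2, h⟩ := Sigma.mk.inj_iff.1 (eq_of_heq h)
  replace h := eq_of_heq h
  rw [h] at hb ha
  rw [he2] at ha hf2
  generalize Int.gcd q.1 (q.2 - m) = g at *
  generalize cofactor m q = e at *
  have he0 : (0 : ℤ) < e := by omega
  have hf : x % e = x' % e := by
    have := Int.emod_nonneg x he0.ne'
    have := Int.emod_nonneg x' he0.ne'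
    omega
  have ha2 : p.1 = q.1 := ha.trans ha'.symm
  refine Prod.ext ha2 ?_
  have hmod : p.2 ≡ q.2 [ZMOD (p.1 : ℤ)] := by
    have e1 : p.2 = m + g * x := by linarith
    have e2 : q.2 = m + g * x' := by linarith
    rw [e1, e2, show (p.1 : ℤ) = g * e by rw [ha]; push_cast; ring]
    exact (Int.ModEq.mul_left' hf).add_left _
  have := hmod.eq
  rwa [Int.emod_eq_of_lt h3 h4, Int.emod_eq_of_lt h3' (by rw [ha2]; exact h4')] at this

lemma exists_toTriple_eq {m N M : ℕ} {t : Σ _ : ℕ, Σ _ : ℕ, ℕ}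
    (ht : t ∈ triples (2 * m) M (fun e => N / e)) :
    ∃ p ∈ sqRoots m N, cofactor m p ≤ M ∧ toTriple m p = t := by
  obtain ⟨e, f, d⟩ := t
  obtain ⟨⟨he, heM⟩, ⟨hf, hc⟩, ⟨hd, hdN⟩, hdvd⟩ := mem_triples.1 ht
  have hde : (0 : ℤ) < d * e := by positivity
  set b : ℤ := ((m : ℤ) + d * f) % (d * e) with hb
  have hbmod : b ≡ m + d * f [ZMOD (d * e)] := Int.mod_modEq _ _
  have hgcd : Int.gcd ((d * e : ℕ) : ℤ) (b - m) = d := by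
    have h1 : b - m ≡ d * f [ZMOD ((d * e : ℕ) : ℤ)] := by
      have := hbmod.sub_right (m : ℤ)
      rw [add_sub_cancel_left] at this
      exact_mod_cast this
    rw [gcd_eq_gcd_of_modEq h1]
    have : Nat.gcd (d * e) (d * f) = d := by
      rw [Nat.gcd_mul_left, hc.gcd_eq_one, mul_one]
    exact_mod_cast this
  have hcof : cofactor m (d * e, b) = e := by
    rw [cofactor]
    simp only
    rw [hgcd, Nat.mul_div_cancel_left _ hd]
  have hmem : (d * e, b) ∈ sqRoots m N := by
    rw [mem_sqRoots]
    refine ⟨Nat.mul_pos hd he, ?_, Int.emod_nonneg _ hde.ne', ?_, ?_⟩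
    · exact (Nat.le_div_iff_mul_le he).1 hdN
    · push_cast; exact Int.emod_lt_of_pos _ hde
    · have h1 : b ^ 2 - (m : ℤ) ^ 2 ≡ (m + d * f) ^ 2 - (m : ℤ) ^ 2 [ZMOD (d * e)] :=
        (hbmod.pow 2).sub_right _
      push_cast
      refine h1.dvd_iff.2 ?_
      have h2 : ((m : ℤ) + d * f) ^ 2 - (m : ℤ) ^ 2 = d * (f * (d * f + 2 * m)) := by ring
      rw [h2]
      refine mul_dvd_mul_left _ (Dvd.dvd.mul_left ?_ _)
      exact_mod_cast hdvd
  refine ⟨(d * e, b), hmem, hcof.trans_le heM, ?_⟩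
  obtain ⟨x, hg, he', ha, hbx, hc', hx⟩ := exists_factorization m (p := (d * e, b))
    (Nat.mul_pos hd he)
  rw [toTriple, hx, hcof]
  simp only at hbx ⊢
  rw [hgcd] at hbx ⊢
  have hxf : (x % (e : ℤ)).toNat = f := by
    have h1 : (d : ℤ) * x ≡ d * f [ZMOD (d * e)] := by
      rw [← hbx]
      simpa using hbmod.sub_right (m : ℤ)
    have h2 : x ≡ f [ZMOD e] := Int.ModEq.mul_left_cancel' (by omega) h1
    rw [h2.eq, Int.emod_eq_of_lt (by omega) (by omega)]
    simp
  rw [hxf]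

lemma card_filter_cofactor_le (m N M : ℕ) :
    ((sqRoots m N).filter (fun p => cofactor m p ≤ M)).card =
      (triples (2 * m) M (fun e => N / e)).card := by
  refine Finset.card_nbij (toTriple m) ?_ ?_ ?_
  · intro p hp
    obtain ⟨hp, hM⟩ := Finset.mem_filter.1 hp
    obtain ⟨h1, h2, -⟩ := mem_sqRoots.1 hp
    obtain ⟨x, hg, he, ha, -⟩ := exists_factorization m h1
    refine toTriple_mem hp hM ((Nat.le_div_iff_mul_le he).2 ?_)
    rw [mul_comm, ← ha]
    exact h2
  · exact (toTriple_injOn m N).mono fun p hp => (Finset.mem_filter.1 hp).1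
  · intro t ht
    obtain ⟨p, hp, hM, rfl⟩ := exists_toTriple_eq ht
    exact ⟨p, Finset.mem_filter.2 ⟨hp, hM⟩, rfl⟩

/-- The pair `(a, -b mod a)`. -/
def negPair (p : ℕ × ℤ) : ℕ × ℤ := (p.1, -p.2 % p.1)

lemma negPair_mem {m N : ℕ} {p : ℕ × ℤ} (hp : p ∈ sqRoots m N) : negPair p ∈ sqRoots m N := by
  obtain ⟨h1, h2, h3, h4, h5⟩ := mem_sqRoots.1 hp
  refine mem_sqRoots.2 ⟨h1, h2, Int.emod_nonneg _ (by omega), Int.emod_lt_of_pos _ (by omega), ?_⟩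
  have h : (-p.2 % p.1) ^ 2 - (m : ℤ) ^ 2 ≡ (-p.2) ^ 2 - (m : ℤ) ^ 2 [ZMOD p.1] :=
    ((Int.mod_modEq (-p.2) p.1).pow 2).sub_right _
  rw [neg_sq] at h
  exact h.dvd_iff.2 h5

lemma negPair_negPair {m N : ℕ} {p : ℕ × ℤ} (hp : p ∈ sqRoots m N) :
    negPair (negPair p) = p := by
  obtain ⟨h1, h2, h3, h4, h5⟩ := mem_sqRoots.1 hp
  refine Prod.ext rfl ?_
  have h : -(-p.2 % p.1) ≡ - -p.2 [ZMOD p.1] := (Int.mod_modEq (-p.2) p.1).neg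
  rw [neg_neg] at h
  exact h.eq.trans (Int.emod_eq_of_lt h3 h4)

lemma cofactor_negPair (m : ℤ) (p : ℕ × ℤ) : cofactor m (negPair p) = cofactor (-m) p := by
  have h : -p.2 % p.1 - m ≡ -(p.2 - -m) [ZMOD p.1] := by
    have := (Int.mod_modEq (-p.2) p.1).sub_right m
    rwa [show -p.2 - m = -(p.2 - -m) by ring] at this
  simp only [cofactor, negPair]
  rw [gcd_eq_gcd_of_modEq h, Int.gcd_neg]

lemma card_filter_cofactor_neg_le (m N M : ℕ) :
    ((sqRoots m N).filter (fun p => cofactor (-m) p ≤ M)).card =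
      ((sqRoots m N).filter (fun p => cofactor m p ≤ M)).card := by
  refine Finset.card_nbij' negPair negPair ?_ ?_ ?_ ?_
  · intro p hp
    obtain ⟨hp, h⟩ := Finset.mem_filter.1 hp
    refine Finset.mem_filter.2 ⟨negPair_mem hp, ?_⟩
    rwa [cofactor_negPair]
  · intro p hp
    obtain ⟨hp, h⟩ := Finset.mem_filter.1 hp
    refine Finset.mem_filter.2 ⟨negPair_mem hp, ?_⟩
    rwa [← cofactor_negPair, negPair_negPair hp]
  · intro p hp
    exact negPair_negPair (Finset.mem_filter.1 hp).1
  · intro p hp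
    exact negPair_negPair (Finset.mem_filter.1 hp).1

lemma cofactor_le_or {m N M : ℕ} (hM : N < (M + 1) ^ 2) {p : ℕ × ℤ} (hp : p ∈ sqRoots m N) :
    cofactor m p ≤ M ∨ cofactor (-m) p ≤ M := by
  obtain ⟨h1, h2, h3, h4, h5⟩ := mem_sqRoots.1 hp
  obtain ⟨-, hg, he, ha, -⟩ := exists_factorization m h1
  obtain ⟨-, hg', he', ha', -⟩ := exists_factorization (-m) h1
  have hdvd : p.1 ∣ Int.gcd p.1 (p.2 - m) * Int.gcd p.1 (p.2 - -m) := by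
    have h6 : (p.1 : ℤ) ∣ (p.2 - m) * (p.2 - -m) := by
      rwa [show (p.2 - m) * (p.2 - -m) = p.2 ^ 2 - (m : ℤ) ^ 2 by ring]
    have h7 : p.1 ∣ (p.2 - m).natAbs * (p.2 - -m).natAbs := by
      rw [← Int.natAbs_mul]
      exact Int.natCast_dvd.1 h6
    have := Nat.gcd_mul_right_dvd_mul_gcd p.1 (p.2 - m).natAbs (p.2 - -m).natAbs
    rw [Nat.gcd_eq_left h7] at this
    exact this
  have hle := Nat.le_of_dvd (Nat.mul_pos hg hg') hdvd
  by_contra! hcon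
  generalize Int.gcd p.1 (p.2 - m) = g at *
  generalize Int.gcd p.1 (p.2 - -m) = g' at *
  generalize cofactor m p = e at *
  generalize cofactor (-m) p = e' at *
  have h8 : (M + 1) * (M + 1) ≤ e * e' := Nat.mul_le_mul hcon.1 hcon.2
  have h9 : (e * e') * p.1 ≤ p.1 * p.1 := by
    calc (e * e') * p.1 ≤ (e * e') * (g * g') := Nat.mul_le_mul_left _ hle
      _ = (e * g) * (e' * g') := by ring
      _ = p.1 * p.1 := by rw [← ha, ← ha']
  have h10 := Nat.le_of_mul_le_mul_right h9 h1
  nlinarith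

lemma gcd_le_of_cofactor_le {m N M : ℕ} (hm : 0 < m) {p : ℕ × ℤ} (hp : p ∈ sqRoots m N)
    (hM : cofactor (-m) p ≤ M) : Int.gcd p.1 (p.2 - m) ≤ 2 * m * M := by
  obtain ⟨h1, h2, h3, h4, h5⟩ := mem_sqRoots.1 hp
  obtain ⟨x, hg, he, ha, hx, -⟩ := exists_factorization m h1
  obtain ⟨x', hg', he', ha', hx', -⟩ := exists_factorization (-m) h1
  generalize Int.gcd p.1 (p.2 - m) = g at *
  generalize Int.gcd p.1 (p.2 - -m) = g' at *
  generalize cofactor m p = e at *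
  generalize cofactor (-m) p = e' at *
  have h6 : Nat.gcd g g' ∣ 2 * m := by
    have h7 : ((Nat.gcd g g' : ℕ) : ℤ) ∣ ((2 * m : ℕ) : ℤ) := by
      have : ((2 * m : ℕ) : ℤ) = (p.2 - -m) - (p.2 - m) := by push_cast; ring
      rw [this, hx, hx']
      exact dvd_sub
        (Dvd.dvd.mul_right (Int.natCast_dvd_natCast.2 (Nat.gcd_dvd_right g g')) _)
        (Dvd.dvd.mul_right (Int.natCast_dvd_natCast.2 (Nat.gcd_dvd_left g g')) _)
    exact_mod_cast h7
  have h8 : Nat.lcm g g' ∣ p.1 := Nat.lcm_dvd (Dvd.intro_left _ ha.symm) (Dvd.intro_left _ ha'.symm)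
  have h9 : g * g' ≤ (2 * m * M) * g' := by
    calc g * g' = Nat.gcd g g' * Nat.lcm g g' := (Nat.gcd_mul_lcm g g').symm
      _ ≤ (2 * m) * p.1 := Nat.mul_le_mul (Nat.le_of_dvd (by omega) h6) (Nat.le_of_dvd h1 h8)
      _ = (2 * m) * (e' * g') := by rw [← ha']
      _ ≤ (2 * m) * (M * g') := by gcongr
      _ = _ := by ring
  exact Nat.le_of_mul_le_mul_right h9 hg'

lemma abs_card_sqRoots_sub_le {m : ℕ} (hm : 0 < m) (N : ℕ) :
    |((sqRoots m N).card : ℝ) -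
      2 * N * ∑ e ∈ Finset.Icc 1 N.sqrt, (e.totient : ℝ) / (e : ℝ) ^ 2| ≤ (2 * m + 5) * N := by
  set M := N.sqrt with hMdef
  have hM1 : M * M ≤ N := Nat.sqrt_le N
  have hM2 : N < (M + 1) ^ 2 := by exact Nat.lt_succ_sqrt' N
  set A := (sqRoots m N).filter (fun p => cofactor m p ≤ M) with hA
  set B := (sqRoots m N).filter (fun p => cofactor (-m) p ≤ M) with hB
  have hAB : A ∪ B = sqRoots m N := by
    rw [hA, hB, ← Finset.filter_or]
    exact Finset.filter_true_of_mem fun p hp => cofactor_le_or hM2 hp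
  have hinter : (A ∩ B).card ≤ (triples (2 * m) M (fun _ => 2 * m * M)).card := by
    refine Finset.card_le_card_of_injOn (toTriple m) ?_ ?_
    · intro p hp
      obtain ⟨hpA, hpB⟩ := Finset.mem_inter.1 hp
      obtain ⟨hp, hpA⟩ := Finset.mem_filter.1 hpA
      exact toTriple_mem hp hpA (gcd_le_of_cofactor_le hm hp (Finset.mem_filter.1 hpB).2)
    · exact (toTriple_injOn m N).mono fun p hp =>
        (Finset.mem_filter.1 (Finset.mem_inter.1 hp).1).1
  have hcard := Finset.card_union_add_card_inter A B
  have hBA : B.card = A.card := card_filter_cofactor_neg_le m N M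
  rw [hAB, hBA] at hcard
  have hcard' : ((sqRoots m N).card : ℝ) + (A ∩ B).card = 2 * A.card := by
    rw [two_mul]; exact_mod_cast hcard
  have hN : (M : ℝ) ^ 2 ≤ N := by rw [sq]; exact_mod_cast hM1
  have hMle : (M : ℝ) ≤ N := by exact_mod_cast Nat.sqrt_le_self N
  have htot : ∀ e ∈ Finset.Icc 1 M, (0 : ℝ) < e ∧ (e.totient : ℝ) / e ≤ 1 := fun e he => by
    have : (0 : ℝ) < e := by exact_mod_cast (Finset.mem_Icc.1 he).1
    exact ⟨this, by rw [div_le_one this]; exact_mod_cast Nat.totient_le e⟩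
  have hI : ((A ∩ B).card : ℝ) ≤ (2 * m + 1) * N := by
    have h1 := (abs_le.1 (abs_card_triples_sub_le (2 * m) M (fun _ => 2 * m * M))).2
    have h2 : ∑ e ∈ Finset.Icc 1 M, (e.totient : ℝ) * (((2 * m * M : ℕ) : ℝ) / e) ≤
        ∑ e ∈ Finset.Icc 1 M, (2 * m * M : ℝ) := by
      refine Finset.sum_le_sum fun e he => ?_
      have := (htot e he).2
      calc (e.totient : ℝ) * (((2 * m * M : ℕ) : ℝ) / e) = e.totient / e * (2 * m * M : ℝ) := by
            push_cast; ring
        _ ≤ 1 * (2 * m * M : ℝ) := by gcongr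
        _ = _ := one_mul _
    rw [Finset.sum_const, Nat.card_Icc, nsmul_eq_mul, Nat.add_sub_cancel] at h2
    have h3 : ((A ∩ B).card : ℝ) ≤ (triples (2 * m) M (fun _ => 2 * m * M)).card := by
      exact_mod_cast hinter
    have hm0 : (0 : ℝ) ≤ m := by positivity
    nlinarith
  have hI0 : (0 : ℝ) ≤ (A ∩ B).card := by positivity
  have hAF : |(A.card : ℝ) - N * ∑ e ∈ Finset.Icc 1 M, (e.totient : ℝ) / (e : ℝ) ^ 2| ≤ 2 * N := by
    have h1 := abs_card_triples_sub_le (2 * m) M (fun e => N / e)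
    rw [← card_filter_cofactor_le m N M] at h1
    have h2 : |∑ e ∈ Finset.Icc 1 M, (e.totient : ℝ) * (((N / e : ℕ) : ℝ) / e) -
        N * ∑ e ∈ Finset.Icc 1 M, (e.totient : ℝ) / (e : ℝ) ^ 2| ≤ M := by
      rw [Finset.mul_sum, ← Finset.sum_sub_distrib]
      refine (Finset.abs_sum_le_sum_abs _ _).trans ?_
      refine (Finset.sum_le_sum (g := fun _ => (1 : ℝ)) fun e he => ?_).trans (by simp)
      obtain ⟨he0, he1⟩ := htot e he
      have h3 : ((N / e : ℕ) : ℝ) ≤ (N : ℝ) / e := Nat.cast_div_le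
      have h4 : (N : ℝ) / e < ((N / e : ℕ) : ℝ) + 1 := by
        rw [← Nat.floor_div_eq_div (K := ℝ)]; exact Nat.lt_floor_add_one _
      have h5 : (e.totient : ℝ) * (((N / e : ℕ) : ℝ) / e) - N * ((e.totient : ℝ) / (e : ℝ) ^ 2) =
          (e.totient : ℝ) / e * (((N / e : ℕ) : ℝ) - N / e) := by
        field_simp
      rw [h5, abs_mul, abs_of_nonneg (by positivity)]
      exact mul_le_one₀ he1 (abs_nonneg _) (abs_le.2 ⟨by linarith, by linarith⟩)
    have h6 := abs_le.1 h1
    have h7 := abs_le.1 h2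
    rw [abs_le]
    constructor <;> linarith [h6.1, h6.2, h7.1, h7.2]
  have h8 := abs_le.1 hAF
  rw [abs_le]
  constructor <;> nlinarith [h8.1, h8.2]

open Classical in
/-- Positive pairs `c < a ≤ N` such that `a * c + m ^ 2` is a square. -/
noncomputable def posPairs (m N : ℕ) : Finset (ℤ × ℤ) :=
  (Finset.Icc 1 (N : ℤ) ×ˢ Finset.Icc 1 (N : ℤ)).filter
    (fun p => p.2 < p.1 ∧ ∃ b : ℤ, b ^ 2 = p.1 * p.2 + (m : ℤ) ^ 2)

lemma mem_posPairs {m N : ℕ} {p : ℤ × ℤ} : p ∈ posPairs m N ↔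
    1 ≤ p.2 ∧ p.2 < p.1 ∧ p.1 ≤ N ∧ ∃ b : ℤ, b ^ 2 = p.1 * p.2 + (m : ℤ) ^ 2 := by
  simp only [posPairs, Finset.mem_filter, Finset.mem_product, Finset.mem_Icc]
  constructor
  · rintro ⟨⟨⟨h1, h2⟩, h3, h4⟩, h5, h6⟩
    exact ⟨h3, h5, h2, h6⟩
  · rintro ⟨h1, h2, h3, h6⟩
    exact ⟨⟨⟨by omega, h3⟩, h1, by omega⟩, h2, h6⟩

lemma card_posPairs_le (m N : ℕ) :
    (posPairs m N).card ≤ (sqRoots m N).card + m ^ 2 * N := by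
  classical
  have hroot : ∀ p ∈ posPairs m N, ∃ b : ℤ, 0 ≤ b ∧ b ^ 2 = p.1 * p.2 + (m : ℤ) ^ 2 := by
    intro p hp
    obtain ⟨-, -, -, b, hb⟩ := mem_posPairs.1 hp
    exact ⟨|b|, abs_nonneg b, by rw [sq_abs, hb]⟩
  choose! β hβ0 hβ using hroot
  let E : Finset (ℕ × ℤ) := (Finset.Icc 1 N ×ˢ Finset.range (m ^ 2)).image
    (fun q => (q.1, (q.1 : ℤ) + q.2))
  have hE : E.card ≤ m ^ 2 * N := by
    refine Finset.card_image_le.trans ?_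
    simp [mul_comm]
  refine le_trans ?_ ((Finset.card_union_le (sqRoots m N) E).trans (Nat.add_le_add_left hE _))
  refine Finset.card_le_card_of_injOn (fun p => (p.1.toNat, β p)) ?_ ?_
  · intro p hp
    obtain ⟨h1, h2, h3, -⟩ := mem_posPairs.1 hp
    have hb0 := hβ0 p hp
    have hb := hβ p hp
    have hn : ((p.1.toNat : ℕ) : ℤ) = p.1 := Int.toNat_of_nonneg (by omega)
    refine Finset.mem_union.2 ?_
    rcases lt_or_ge (β p) p.1 with hlt | hge
    · left
      refine mem_sqRoots.2 ⟨?_, ?_, hb0, ?_, ?_⟩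
      · simp only; omega
      · simp only; omega
      · simp only; omega
      · simp only
        rw [hn, hb]
        exact ⟨p.2, by ring⟩
    · right
      refine Finset.mem_image.2 ⟨(p.1.toNat, (β p - p.1).toNat), ?_, ?_⟩
      · refine Finset.mem_product.2 ⟨Finset.mem_Icc.2 ⟨?_, ?_⟩, Finset.mem_range.2 ?_⟩
        · simp only; omega
        · simp only; omega
        · have : β p - p.1 < (m : ℤ) ^ 2 := by nlinarith
          simp only
          zify
          rw [Int.toNat_of_nonneg (by omega)]
          exact this
      · refine Prod.ext rfl ?_
        simp only
        rw [hn, Int.toNat_of_nonneg (by omega)]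
        ring
  · intro p hp q hq h
    obtain ⟨h1, h2, -⟩ := mem_posPairs.1 hp
    obtain ⟨h1', h2', -⟩ := mem_posPairs.1 hq
    obtain ⟨ha, hb⟩ := Prod.ext_iff.1 h
    simp only at ha hb
    have ha' : p.1 = q.1 := by omega
    have e1 := hβ p hp
    have e2 := hβ q hq
    rw [← hb, e1, ha'] at e2
    exact Prod.ext ha' (mul_left_cancel₀ (by omega : q.1 ≠ 0) (by linarith))

lemma card_sqRoots_le (m N : ℕ) :
    (sqRoots m N).card ≤ (posPairs m N).card + (m + 1) * N := by
  have h1 : ((sqRoots m N).filter (fun p => (m : ℤ) < p.2)).card ≤ (posPairs m N).card := by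
    have key : ∀ p ∈ (sqRoots m N).filter (fun p => (m : ℤ) < p.2), 0 < (p.1 : ℤ) ∧ 0 ≤ p.2 ∧
        (p.1 : ℤ) * ((p.2 ^ 2 - (m : ℤ) ^ 2) / p.1) = p.2 ^ 2 - (m : ℤ) ^ 2 := fun p hp => by
      obtain ⟨h1, h2, h3, h4, h5⟩ := mem_sqRoots.1 (Finset.mem_filter.1 hp).1
      exact ⟨by omega, h3, Int.mul_ediv_cancel' h5⟩
    refine Finset.card_le_card_of_injOn
      (fun p => ((p.1 : ℤ), (p.2 ^ 2 - (m : ℤ) ^ 2) / (p.1 : ℤ))) ?_ ?_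
    · intro p hp
      obtain ⟨h0, -, hc⟩ := key p hp
      obtain ⟨hp, hm⟩ := Finset.mem_filter.1 hp
      obtain ⟨h1, h2, h3, h4, h5⟩ := mem_sqRoots.1 hp
      refine mem_posPairs.2 ?_
      simp only
      generalize (p.2 ^ 2 - (m : ℤ) ^ 2) / (p.1 : ℤ) = c at *
      refine ⟨?_, ?_, by omega, p.2, by linarith⟩
      · have : 0 < (p.1 : ℤ) * c := by rw [hc]; nlinarith
        exact (pos_iff_pos_of_mul_pos this).1 h0
      · have : (p.1 : ℤ) * c < p.1 * p.1 := by rw [hc]; nlinarith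
        exact lt_of_mul_lt_mul_left this h0.le
    · intro p hp q hq h
      obtain ⟨h0, hb, hc⟩ := key p hp
      obtain ⟨h0', hb', hc'⟩ := key q hq
      obtain ⟨e1, e2⟩ := Prod.ext_iff.1 h
      simp only at e1 e2
      rw [e2, e1, hc'] at hc
      refine Prod.ext (by exact_mod_cast e1) ?_
      exact (pow_left_inj₀ hb hb' two_ne_zero).1 (by linarith)
  have h2 : ((sqRoots m N).filter (fun p => ¬ (m : ℤ) < p.2)).card ≤ (m + 1) * N := by
    have : (Finset.Icc 1 N ×ˢ Finset.Icc 0 (m : ℤ)).card = (m + 1) * N := by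
      rw [Finset.card_product, Nat.card_Icc, Int.card_Icc, mul_comm]
      congr 1
    rw [← this]
    refine Finset.card_le_card fun p hp => ?_
    obtain ⟨hp, hm⟩ := Finset.mem_filter.1 hp
    obtain ⟨h1, h2, h3, -⟩ := mem_sqRoots.1 hp
    exact Finset.mem_product.2 ⟨Finset.mem_Icc.2 ⟨h1, h2⟩, Finset.mem_Icc.2 ⟨h3, by omega⟩⟩
  rw [← Finset.card_filter_add_card_filter_not (fun p : ℕ × ℤ => (m : ℤ) < p.2)]
  exact Nat.add_le_add h1 h2

lemma abs_intCast_le_iff {T : ℝ} (hT : 0 ≤ T) (x : ℤ) : |(x : ℝ)| ≤ T ↔ |x| ≤ (⌊T⌋₊ : ℤ) := by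
  rw [Int.abs_eq_natAbs, Nat.cast_le, Nat.le_floor_iff hT, Nat.cast_natAbs, Int.cast_abs]

lemma DTn_bounds (m : ℕ) {T : ℝ} (hT : 0 ≤ T) :
    2 * (posPairs m ⌊T⌋₊).card ≤ DTn ((m : ℤ) ^ 2) T ∧
      DTn ((m : ℤ) ^ 2) T ≤ 2 * (posPairs m ⌊T⌋₊).card + m ^ 4 := by
  classical
  set N := ⌊T⌋₊ with hN
  let P := posPairs m N
  let Q : Finset (ℤ × ℤ) := P.image (fun p => (-p.2, -p.1))
  let R : Finset (ℤ × ℤ) := Finset.Icc 1 ((m : ℤ) ^ 2) ×ˢ Finset.Icc (-(m : ℤ) ^ 2) (-1)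
  have hQ : Q.card = P.card := by
    refine Finset.card_image_of_injective _ fun p q h => ?_
    obtain ⟨h1, h2⟩ := Prod.ext_iff.1 h
    simp only at h1 h2
    exact Prod.ext (by omega) (by omega)
  have hR : R.card = m ^ 4 := by
    rw [Finset.card_product, Int.card_Icc, Int.card_Icc]
    have e1 : ((m : ℤ) ^ 2 + 1 - 1).toNat = m ^ 2 := by
      rw [add_sub_cancel_right]; exact_mod_cast Int.toNat_natCast (m ^ 2)
    have e2 : (-1 + 1 - -(m : ℤ) ^ 2).toNat = m ^ 2 := by
      rw [neg_add_cancel, zero_sub, neg_neg]; exact_mod_cast Int.toNat_natCast (m ^ 2)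
    rw [e1, e2]
    ring
  have hPQ : Disjoint P Q := by
    rw [Finset.disjoint_left]
    intro p hp hq
    obtain ⟨q, hq', rfl⟩ := Finset.mem_image.1 hq
    obtain ⟨h1, -⟩ := mem_posPairs.1 hp
    obtain ⟨h2, h3, -⟩ := mem_posPairs.1 hq'
    simp only at h1
    omega
  have hcard : (P ∪ Q).card = 2 * P.card := by
    rw [Finset.card_union_of_disjoint hPQ, hQ, two_mul]
  have habs : ∀ x : ℤ, |(x : ℝ)| ≤ T ↔ -(N : ℤ) ≤ x ∧ x ≤ N := fun x => by
    rw [abs_intCast_le_iff hT, abs_le]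
  rw [DTn]
  set W : Set (ℤ × ℤ) := {ac : ℤ × ℤ | ac.2 < ac.1 ∧ ac.1 ≠ 0 ∧ ac.2 ≠ 0 ∧
    |(ac.1 : ℝ)| ≤ T ∧ |(ac.2 : ℝ)| ≤ T ∧ ∃ b : ℤ, b ^ 2 = ac.1 * ac.2 + (m : ℤ) ^ 2} with hW
  have hsub1 : ((P ∪ Q : Finset (ℤ × ℤ)) : Set (ℤ × ℤ)) ⊆ W := by
    intro p hp
    rcases Finset.mem_union.1 hp with hp | hp
    · obtain ⟨h1, h2, h3, h4⟩ := mem_posPairs.1 hp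
      refine ⟨h2, by omega, by omega, (habs _).2 ⟨by omega, by omega⟩,
        (habs _).2 ⟨by omega, by omega⟩, h4⟩
    · obtain ⟨q, hq, rfl⟩ := Finset.mem_image.1 hp
      obtain ⟨h1, h2, h3, b, hb⟩ := mem_posPairs.1 hq
      refine ⟨by simp only; omega, by simp only; omega, by simp only; omega,
        (habs _).2 ⟨by simp only; omega, by simp only; omega⟩,
        (habs _).2 ⟨by simp only; omega, by simp only; omega⟩, b, ?_⟩
      rw [hb]
      ring
  have hsub2 : W ⊆ ((P ∪ Q ∪ R : Finset (ℤ × ℤ)) : Set (ℤ × ℤ)) := by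
    rintro ⟨a, c⟩ ⟨h1, h2, h3, h4, h5, b, hb⟩
    rw [habs] at h4 h5
    simp only at *
    rw [Finset.mem_coe, Finset.mem_union, Finset.mem_union]
    rcases lt_or_gt_of_ne h3 with hc | hc
    · rcases lt_or_gt_of_ne h2 with ha | ha
      · left; right
        refine Finset.mem_image.2 ⟨(-c, -a), mem_posPairs.2 ⟨?_, ?_, ?_, b, ?_⟩, by simp⟩
        · simp only; omega
        · simp only; omega
        · simp only; omega
        · rw [hb]; ring
      · right
        have h6 : a * (-c) ≤ (m : ℤ) ^ 2 := by nlinarith [sq_nonneg b]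
        refine Finset.mem_product.2 ⟨Finset.mem_Icc.2 ⟨ha, ?_⟩, Finset.mem_Icc.2 ⟨?_, by omega⟩⟩
        · simp only; nlinarith
        · simp only; nlinarith
    · left; left
      exact mem_posPairs.2 ⟨hc, h1, h4.2, b, hb⟩
  have hfin : W.Finite := (Finset.finite_toSet _).subset hsub2
  constructor
  · rw [← hcard, ← Set.ncard_coe_finset]
    exact Set.ncard_le_ncard hsub1 hfin
  · rw [← hcard, ← hR]
    refine le_trans ?_ (Finset.card_union_le _ _)
    rw [← Set.ncard_coe_finset]
    exact Set.ncard_le_ncard hsub2 (Finset.finite_toSet _)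

lemma exists_abs_DTn_sub_le {m : ℕ} (hm : 0 < m) : ∃ C : ℝ, ∀ T : ℝ, 1 ≤ T →
    |(DTn ((m : ℤ) ^ 2) T : ℝ) - 4 * ⌊T⌋₊ *
      ∑ e ∈ Finset.Icc 1 (Nat.sqrt ⌊T⌋₊), (e.totient : ℝ) / (e : ℝ) ^ 2| ≤ C * T := by
  refine ⟨2 * (2 * m + 5) + 2 * (m ^ 2 + m + 1) + m ^ 4, fun T hT => ?_⟩
  have hT0 : 0 ≤ T := by linarith
  have hN : (⌊T⌋₊ : ℝ) ≤ T := Nat.floor_le hT0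
  obtain ⟨h1, h2⟩ := DTn_bounds m hT0
  have h3 := card_posPairs_le m ⌊T⌋₊
  have h4 := card_sqRoots_le m ⌊T⌋₊
  have h5 := abs_le.1 (abs_card_sqRoots_sub_le hm ⌊T⌋₊)
  generalize ∑ e ∈ Finset.Icc 1 (Nat.sqrt ⌊T⌋₊), (e.totient : ℝ) / (e : ℝ) ^ 2 = F at *
  generalize DTn ((m : ℤ) ^ 2) T = D at *
  generalize (posPairs m ⌊T⌋₊).card = P at *
  generalize (sqRoots m ⌊T⌋₊).card = S at *
  generalize ⌊T⌋₊ = N at *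
  rify at h1 h2 h3 h4
  have hm0 : (0 : ℝ) ≤ m := by positivity
  have e1 : (2 * (2 * m + 5) + 2 * (m ^ 2 + m + 1) : ℝ) * N ≤
      (2 * (2 * m + 5) + 2 * (m ^ 2 + m + 1)) * T := by gcongr
  have e2 : (m : ℝ) ^ 4 ≤ m ^ 4 * T := le_mul_of_one_le_right (by positivity) hT
  have e3 : (0 : ℝ) ≤ m ^ 2 * N := by positivity
  have e4 : (0 : ℝ) ≤ m * N := by positivity
  have e5 : (0 : ℝ) ≤ N := by positivity
  have e6 : (0 : ℝ) ≤ (m : ℝ) ^ 4 := by positivity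
  rw [abs_le]
  constructor <;> linarith [h5.1, h5.2]

lemma tendsto_log_floor_div_log :
    Tendsto (fun x : ℝ => Real.log ⌊x⌋₊ / Real.log x) atTop (nhds 1) := by
  have hz : Tendsto (fun x : ℝ => 1 - Real.log 2 / Real.log x) atTop (nhds 1) := by
    simpa using (Real.tendsto_log_atTop.const_div_atTop (Real.log 2)).const_sub 1
  refine tendsto_of_tendsto_of_tendsto_of_le_of_le' hz tendsto_const_nhds ?_ ?_
  · filter_upwards [eventually_ge_atTop 2] with x hx
    have hl := Real.log_pos (by linarith : 1 < x)
    rw [le_div_iff₀ hl, sub_mul, div_mul_cancel₀ _ hl.ne', one_mul,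
      ← Real.log_div (by linarith) two_ne_zero]
    exact Real.log_le_log (by linarith) (by linarith [Nat.lt_floor_add_one x])
  · filter_upwards [eventually_ge_atTop 2] with x hx
    have hl := Real.log_pos (by linarith : 1 < x)
    rw [div_le_one hl]
    exact Real.log_le_log (by exact_mod_cast Nat.floor_pos.2 (by linarith))
      (Nat.floor_le (by linarith))

lemma tendsto_main_term :
    Tendsto (fun T : ℝ => 4 * ⌊T⌋₊ *
      (∑ e ∈ Finset.Icc 1 (Nat.sqrt ⌊T⌋₊), (e.totient : ℝ) / (e : ℝ) ^ 2) / (T * Real.log T))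
      atTop (nhds (12 / π ^ 2)) := by
  have hfl : Tendsto (fun T : ℝ => ⌊T⌋₊) atTop atTop := tendsto_nat_floor_atTop
  have hflR : Tendsto (fun T : ℝ => (⌊T⌋₊ : ℝ)) atTop atTop :=
    tendsto_natCast_atTop_atTop.comp hfl
  have hsq : Tendsto (fun T : ℝ => Real.sqrt ⌊T⌋₊) atTop atTop :=
    Real.tendsto_sqrt_atTop.comp hflR
  have hM : Tendsto (fun T : ℝ => Nat.sqrt ⌊T⌋₊) atTop atTop := by
    refine (tendsto_nat_floor_atTop.comp hsq).congr fun T => ?_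
    exact Real.nat_floor_real_sqrt_eq_nat_sqrt
  have h1 : Tendsto (fun T : ℝ => (⌊T⌋₊ : ℝ) / T) atTop (nhds 1) :=
    tendsto_nat_floor_div_atTop
  have h2 := tendsto_sum_totient_div_sq.comp hM
  have h3 : Tendsto (fun T : ℝ => Real.log (Nat.sqrt ⌊T⌋₊) / Real.log (Real.sqrt ⌊T⌋₊))
      atTop (nhds 1) := by
    refine (tendsto_log_floor_div_log.comp hsq).congr fun T => ?_
    simp only [Function.comp_apply]
    rw [Real.nat_floor_real_sqrt_eq_nat_sqrt]
  have h := ((((h1.mul h2).mul h3).mul tendsto_log_floor_div_log).const_mul 2)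
  rw [show 2 * (1 * (6 / π ^ 2) * 1 * 1) = 12 / π ^ 2 by ring] at h
  refine h.congr' ?_
  filter_upwards [eventually_gt_atTop 1, hfl.eventually_ge_atTop 2, hM.eventually_ge_atTop 2]
    with T hT hN hM
  have l1 := (Real.log_pos hT).ne'
  have l2 : Real.log (⌊T⌋₊ : ℝ) ≠ 0 := (Real.log_pos (by exact_mod_cast hN)).ne'
  have l3 : Real.log (Nat.sqrt ⌊T⌋₊ : ℝ) ≠ 0 := (Real.log_pos (by exact_mod_cast hM)).ne'
  have hT0 : T ≠ 0 := by linarith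
  simp only [Function.comp_apply]
  rw [Real.log_sqrt (by positivity)]
  generalize ∑ e ∈ Finset.Icc 1 (Nat.sqrt ⌊T⌋₊), (e.totient : ℝ) / (e : ℝ) ^ 2 = F
  field_simp
  ring

/-- **Theorem 3 (c).** Let `n > 0` be a perfect square. Then, as `T → ∞`,
`D_T^n = 12 T log T / π² + o(T log T)`. -/
theorem total_count_square (n : ℤ) (hn : 0 < n) (hsq : ∃ m : ℤ, n = m ^ 2) :
    (fun T : ℝ => (DTn n T : ℝ) - 12 * T * Real.log T / Real.pi ^ 2)
      =o[atTop] (fun T : ℝ => T * Real.log T) := by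
  obtain ⟨m, hm, rfl⟩ : ∃ m : ℕ, 0 < m ∧ n = (m : ℤ) ^ 2 := by
    obtain ⟨k, rfl⟩ := hsq
    exact ⟨k.natAbs, Int.natAbs_pos.2 (by rintro rfl; simp at hn), by simp⟩
  obtain ⟨C, hC⟩ := exists_abs_DTn_sub_le hm
  set G : ℝ → ℝ := fun T => 4 * ⌊T⌋₊ *
    ∑ e ∈ Finset.Icc 1 (Nat.sqrt ⌊T⌋₊), (e.totient : ℝ) / (e : ℝ) ^ 2 with hG
  have h1 : (fun T : ℝ => (DTn ((m : ℤ) ^ 2) T : ℝ) - G T) =o[atTop]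
      (fun T : ℝ => T * Real.log T) := by
    have hO : (fun T : ℝ => (DTn ((m : ℤ) ^ 2) T : ℝ) - G T) =O[atTop] (fun T : ℝ => T * 1) := by
      refine IsBigO.of_bound C ?_
      filter_upwards [eventually_ge_atTop 1] with T hT
      rw [Real.norm_eq_abs, Real.norm_eq_abs, mul_one, abs_of_nonneg (by linarith : 0 ≤ T)]
      exact hC T hT
    exact hO.trans_isLittleO
      ((isBigO_refl _ _).mul_isLittleO (isLittleO_const_log_atTop (c := 1)))
  have h2 : (fun T : ℝ => G T - 12 * T * Real.log T / Real.pi ^ 2) =o[atTop]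
      (fun T : ℝ => T * Real.log T) := by
    have hne : ∀ᶠ T : ℝ in atTop, T * Real.log T ≠ 0 := by
      filter_upwards [eventually_gt_atTop 1] with T hT
      exact mul_ne_zero (by linarith) (Real.log_pos hT).ne'
    rw [isLittleO_iff_tendsto' (hne.mono fun T h h0 => absurd h0 h)]
    have := tendsto_main_term.sub_const (12 / π ^ 2)
    rw [sub_self] at this
    refine this.congr' (hne.mono fun T h => ?_)
    simp only [hG]
    rw [sub_div (4 * _ * _)]
    congr 1
    rw [eq_div_iff h]
    ring
  exact (h1.add h2).congr_left fun T => by ring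
end
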